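/- arXiv:2011.08168 — 7 statements merged into one kernel-verified Lean document; each statement's English description precedes it below -/
import Mathlib

section
/- (Corollary 3.11) Let f : 𝕎 → ℍ be an M-bilipschitz map, M ≥ 1, and let ε ∈ (0,1), H ≥ 1 and Σ > 0. Then there exist C₀ ≥ 10, depending only on ε, H and M, and δ₀ > 0, depending only on ε, C₀, H and M, such that for all C ≥ C₀ and all δ ∈ (0, δ₀]: if Q ∈ 𝒟 is (δ, CH, Σ)-ruled, then Q is (ε, H, Σ)-vertical. -/
open scoped ENNReal

namespace HeisRug

/-- The first Heisenberg group, as a set: ℝ³. -/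
abbrev Hei : Type := ℝ × ℝ × ℝ

/-- Heisenberg group multiplication. -/
noncomputable def Hmul (p q : Hei) : Hei :=
  (p.1 + q.1, p.2.1 + q.2.1, p.2.2 + q.2.2 + (p.1 * q.2.1 - q.1 * p.2.1) / 2)

/-- Heisenberg group inverse. -/
def Hinv (p : Hei) : Hei := (-p.1, -p.2.1, -p.2.2)

/-- Homogeneous norm on the Heisenberg group. -/
noncomputable def Hnorm (p : Hei) : ℝ :=
  max (Real.sqrt (p.1 ^ 2 + p.2.1 ^ 2)) (Real.sqrt |p.2.2|)

/-- Left-invariant metric `d(p,q) = ‖q⁻¹·p‖` on the Heisenberg group. -/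
noncomputable def dH (p q : Hei) : ℝ := Hnorm (Hmul (Hinv q) p)

/-- Parabolic metric on the parabolic plane 𝕎 = ℝ². -/
noncomputable def dPar (w w' : ℝ × ℝ) : ℝ :=
  max |w.1 - w'.1| (Real.sqrt |w.2 - w'.2|)

/-- Distance from a point to a set in (ℍ, d). -/
noncomputable def distH (p : Hei) (E : Set Hei) : ℝ := sInf ((dH p) '' E)

/-- Closed δ-neighbourhood of a set in ℍ. -/
def NH (E : Set Hei) (δ : ℝ) : Set Hei := {p | distH p E ≤ δ}

/-- Closed ball in (ℍ, d). -/
def BH (p : Hei) (r : ℝ) : Set Hei := {q | dH q p ≤ r}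

/-- Closed parabolic ball in 𝕎. -/
def BPar (w : ℝ × ℝ) (r : ℝ) : Set (ℝ × ℝ) := {v | dPar v w ≤ r}

/-- Diameter (in ℝ≥0∞) with respect to the Heisenberg metric. -/
noncomputable def ediamH (E : Set Hei) : ℝ≥0∞ :=
  ⨆ p ∈ E, ⨆ q ∈ E, ENNReal.ofReal (dH p q)

/-- The 3-dimensional Hausdorff measure on (ℍ, d), as a set function. -/
noncomputable def H3 (E : Set Hei) : ℝ≥0∞ :=
  ⨆ (δ : ℝ≥0∞) (_ : 0 < δ),
    ⨅ (U : ℕ → Set Hei) (_ : E ⊆ ⋃ n, U n) (_ : ∀ n, ediamH (U n) ≤ δ),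
      ∑' n, ediamH (U n) ^ 3

/-- Isometric embedding of the parabolic plane onto the subgroup 𝕎 ⊂ ℍ. -/
def embedW (w : ℝ × ℝ) : Hei := (0, w.1, w.2)

/-- The vertical subgroup 𝕎 = {(0,y,t)} of ℍ. -/
def Wsub : Set Hei := {p | p.1 = 0}

/-- Rotation by angle θ about the t-axis. -/
noncomputable def Rrot (θ : ℝ) (p : Hei) : Hei :=
  (p.1 * Real.cos θ - p.2.1 * Real.sin θ, p.1 * Real.sin θ + p.2.1 * Real.cos θ, p.2.2)

/-- Vertical projection Π : ℍ → 𝕎. -/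
noncomputable def Piproj (p : Hei) : Hei := (0, p.2.1, p.2.2 + p.1 * p.2.1 / 2)

/-- Horizontal projection Π_𝕃 : ℍ → 𝕃. -/
def PiL (p : Hei) : Hei := (p.1, 0, 0)

/-- Vertical projection Π_θ = R_θ ∘ Π ∘ R_θ⁻¹ onto 𝕎_θ. -/
noncomputable def PiTheta (θ : ℝ) (p : Hei) : Hei := Rrot θ (Piproj (Rrot (-θ) p))

/-- `f : 𝕎 → ℍ` is M-bilipschitz. -/
def IsBilipschitz (M : ℝ) (f : ℝ × ℝ → Hei) : Prop :=
  ∀ w w' : ℝ × ℝ,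
    M⁻¹ * dPar w w' ≤ dH (f w) (f w') ∧ dH (f w) (f w') ≤ M * dPar w w'

/-- A Rickman rug: the image of the parabolic plane under a bilipschitz map. -/
def IsRickmanRug (E : Set Hei) : Prop :=
  ∃ M : ℝ, 1 ≤ M ∧ ∃ f : ℝ × ℝ → Hei, IsBilipschitz M f ∧ E = Set.range f

/-- A horizontal line in ℍ. -/
def IsHorizontalLine (L : Set Hei) : Prop :=
  ∃ p : Hei, ∃ v : ℝ × ℝ, v ≠ 0 ∧
    L = {q | ∃ s : ℝ, q = Hmul p (s * v.1, s * v.2, 0)}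

/-- The vertical plane spanned by a horizontal line. -/
def VSpan (L : Set Hei) : Set Hei := {q | ∃ p ∈ L, ∃ t : ℝ, q = Hmul p (0, 0, t)}

/-- Vertical planes in ℍ. -/
def IsVerticalPlane (V : Set Hei) : Prop :=
  ∃ L : Set Hei, IsHorizontalLine L ∧ V = VSpan L

/-- The horizontal line {(a·y + b, y, b·y/2 + c) : y ∈ ℝ} (of slope |a|). -/
def hline (a b c : ℝ) : Set Hei :=
  {p | ∃ y : ℝ, p = (a * y + b, y, b * y / 2 + c)}

/-- A horizontal line of (finite) slope at most Σ. -/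
def HLineSlopeLe (S : ℝ) (L : Set Hei) : Prop :=
  ∃ a b c : ℝ, |a| ≤ S ∧ L = hline a b c

/-- A vertical plane of (finite) slope at most Σ (relative to 𝕎). -/
def VPlaneSlopeLe (S : ℝ) (V : Set Hei) : Prop :=
  ∃ a b : ℝ, |a| ≤ S ∧ V = {p : Hei | p.1 = a * p.2.1 + b}

/-- A vertical plane whose slope relative to 𝕎_θ equals 0. -/
def SlopeZeroRel (θ : ℝ) (V : Set Hei) : Prop :=
  ∃ b : ℝ, Rrot (-θ) '' V = {p : Hei | p.1 = b}

/-- The horizontal line ℝ × {t} in the parabolic plane. -/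
def lineW (t : ℝ) : Set (ℝ × ℝ) := {w | w.2 = t}

/-- Ruler coefficient ρ_f(B_par(w,r)). -/
noncomputable def rulerCoef (f : ℝ × ℝ → Hei) (w : ℝ × ℝ) (r : ℝ) : ℝ :=
  sInf {ρ : ℝ | 0 < ρ ∧ ∀ t : ℝ, ∃ L : Set Hei, IsHorizontalLine L ∧
    f '' (lineW t ∩ BPar w r) ⊆ NH L (ρ * r)}

/-- β_f(𝕍; B_par(w,r)): approximation number relative to the vertical plane 𝕍. -/
noncomputable def betaV (f : ℝ × ℝ → Hei) (V : Set Hei) (w : ℝ × ℝ) (r : ℝ) : ℝ :=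
  sInf {ε : ℝ | 0 < ε ∧ ∀ t : ℝ, ∃ L : Set Hei, IsHorizontalLine L ∧ L ⊆ V ∧
    f '' (lineW t ∩ BPar w r) ⊆ NH L (ε * r)}

/-- The strong vertical β-number β_f(B_par(w,r)) = inf_𝕍 β_f(𝕍; B_par(w,r)). -/
noncomputable def beta (f : ℝ × ℝ → Hei) (w : ℝ × ℝ) (r : ℝ) : ℝ :=
  sInf {b : ℝ | ∃ V : Set Hei, IsVerticalPlane V ∧ b = betaV f V w r}

/-- Index set for dyadic parabolic rectangles: (n, k, l). -/
abbrev Idx : Type := ℤ × ℤ × ℤ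

/-- Side length ℓ(Q) = 2⁻ⁿ of the dyadic parabolic rectangle with index (n,k,l). -/
noncomputable def sideLen (i : Idx) : ℝ := (2 : ℝ) ^ (-i.1)

/-- The dyadic parabolic rectangle [k·2⁻ⁿ, (k+1)·2⁻ⁿ) × [l·4⁻ⁿ, (l+1)·4⁻ⁿ). -/
noncomputable def rect (i : Idx) : Set (ℝ × ℝ) :=
  Set.Ico ((i.2.1 : ℝ) * (2 : ℝ) ^ (-i.1)) (((i.2.1 : ℝ) + 1) * (2 : ℝ) ^ (-i.1)) ×ˢ
  Set.Ico ((i.2.2 : ℝ) * (4 : ℝ) ^ (-i.1)) (((i.2.2 : ℝ) + 1) * (4 : ℝ) ^ (-i.1))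

/-- The centre c_Q of a dyadic parabolic rectangle. -/
noncomputable def center (i : Idx) : ℝ × ℝ :=
  (((i.2.1 : ℝ) + 1 / 2) * (2 : ℝ) ^ (-i.1), ((i.2.2 : ℝ) + 1 / 2) * (4 : ℝ) ^ (-i.1))

/-- λQ := B_par(c_Q, λ·ℓ(Q)). -/
noncomputable def dilate (lam : ℝ) (i : Idx) : Set (ℝ × ℝ) := BPar (center i) (lam * sideLen i)

/-- j indexes a 𝒟-child of the rectangle indexed by i. -/
def IsChild (j i : Idx) : Prop := j.1 = i.1 + 1 ∧ rect j ⊆ rect i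

/-- T ⊆ 𝒟 is a tree with root rt. -/
def IsTreeWithRoot (T : Set Idx) (rt : Idx) : Prop :=
  rt ∈ T ∧ (∀ i ∈ T, rect i ⊆ rect rt) ∧
  (∀ i j k : Idx, i ∈ T → k ∈ T → rect i ⊆ rect j → rect j ⊆ rect k → j ∈ T) ∧
  (∀ i ∈ T, (∀ j : Idx, IsChild j i → j ∈ T) ∨ (∀ j : Idx, IsChild j i → j ∉ T))

/-- T ⊆ 𝒟 is a tree. -/
def IsTree (T : Set Idx) : Prop := ∃ rt : Idx, IsTreeWithRoot T rt

/-- Q is (ε,H,Σ)-vertical for f : there is a vertical plane 𝕍_Q of slope ≤ Σ with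
β_f(𝕍_Q; HQ) < ε/H. -/
def IsVerticalRect (f : ℝ × ℝ → Hei) (ε Hc S : ℝ) (i : Idx) : Prop :=
  ∃ V : Set Hei, VPlaneSlopeLe S V ∧ betaV f V (center i) (Hc * sideLen i) < ε / Hc

/-- Q is (δ,C)-ruled for f. -/
def IsRuled (f : ℝ × ℝ → Hei) (δ C : ℝ) (i : Idx) : Prop :=
  ∀ t : ℝ, ∃ L : Set Hei, IsHorizontalLine L ∧
    f '' (lineW t ∩ dilate C i) ⊆ NH L (δ * sideLen i)

/-- Q is (δ,C,Σ)-ruled for f. -/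
def IsRuledSlope (f : ℝ × ℝ → Hei) (δ C S : ℝ) (i : Idx) : Prop :=
  IsRuled f δ C i ∧ ∃ t : ℝ, (lineW t ∩ rect i).Nonempty ∧
    ∃ L : Set Hei, HLineSlopeLe S L ∧
      f '' (lineW t ∩ dilate C i) ⊆ NH L (δ * sideLen i)

/-- Γ is an intrinsic L-Lipschitz graph over 𝕎. -/
def IsIntrinsicLipGraph (L : ℝ) (Γ : Set Hei) : Prop :=
  Set.BijOn Piproj Γ Wsub ∧
  ∀ p ∈ Γ, ∀ q ∈ Γ,
    Hnorm (PiL (Hmul (Hinv q) p)) ≤ L * Hnorm (Piproj (Hmul (Hinv q) p))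

/-- Γ is an intrinsic L-Lipschitz graph over 𝕎_θ. -/
def IsIntrinsicLipGraphOver (θ L : ℝ) (Γ : Set Hei) : Prop :=
  IsIntrinsicLipGraph L (Rrot (-θ) '' Γ)

/-- An intrinsic bilipschitz graph: an intrinsic Lipschitz graph over some vertical
subgroup which is also a Rickman rug. -/
def IsIntrinsicBilipGraph (Γ : Set Hei) : Prop :=
  (∃ θ ∈ Set.Ico (-(Real.pi / 2)) (Real.pi / 2), ∃ L : ℝ, 1 ≤ L ∧
    IsIntrinsicLipGraphOver θ L Γ) ∧ IsRickmanRug Γ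

/-- (M,ε)-quasi-isometric embedding between sets with distance functions. -/
def IsQIEOn {X Y : Type*} (dX : X → X → ℝ) (dY : Y → Y → ℝ) (A : Set X)
    (M ε : ℝ) (F : X → Y) : Prop :=
  ∀ x ∈ A, ∀ x' ∈ A,
    M⁻¹ * dX x x' - ε ≤ dY (F x) (F x') ∧ dY (F x) (F x') ≤ M * dX x x' + ε

/-- d is a metric on ℝ. -/
def IsMetricOn (d : ℝ → ℝ → ℝ) : Prop :=
  (∀ x y, d x y = d y x) ∧ (∀ x y, d x y = 0 ↔ x = y) ∧
  (∀ x y z, d x z ≤ d x y + d y z)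

/-- d is an orderly metric on ℝ. -/
def Orderly (d : ℝ → ℝ → ℝ) : Prop :=
  IsMetricOn d ∧
  (∀ x : ℝ, ∀ ε > (0 : ℝ), ∃ δ > (0 : ℝ), ∀ y : ℝ, |x - y| < δ → d x y < ε) ∧
  (∀ x y z : ℝ, x ≤ y → y ≤ z → max (d x y) (d y z) ≤ d x z)

/-- F : I×J → 𝕎 is a horizontal (M,ε)-QIE. -/
def IsHorizQIE (M ε : ℝ) (I J : Set ℝ) (F : ℝ × ℝ → ℝ × ℝ) : Prop :=
  IsQIEOn dPar dPar (I ×ˢ J) M ε F ∧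
  (∀ t ∈ J, ∃ c : ℝ, ∀ y ∈ I, (F (y, t)).2 = c)


theorem Hnorm_nonneg (p : Hei) : 0 ≤ Hnorm p := le_max_of_le_left (Real.sqrt_nonneg _)

theorem Hnorm_le_iff (p : Hei) (D : ℝ) (hD : 0 ≤ D) :
    Hnorm p ≤ D ↔ p.1 ^ 2 + p.2.1 ^ 2 ≤ D ^ 2 ∧ |p.2.2| ≤ D ^ 2 := by
  unfold Hnorm
  rw [max_le_iff, Real.sqrt_le_left hD, Real.sqrt_le_left hD]

theorem Hnorm_mul_le (p q : Hei) : Hnorm (Hmul p q) ≤ Hnorm p + Hnorm q := by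
  have hp := Hnorm_nonneg p
  have hq := Hnorm_nonneg q
  obtain ⟨p1, p2⟩ := (Hnorm_le_iff p _ hp).1 le_rfl
  obtain ⟨q1, q2⟩ := (Hnorm_le_iff q _ hq).1 le_rfl
  generalize Hnorm p = P at *
  generalize Hnorm q = Q at *
  rw [Hnorm_le_iff _ _ (add_nonneg hp hq)]
  obtain ⟨a, b, c⟩ := p
  obtain ⟨x, y, z⟩ := q
  simp only [Hmul] at *
  have hPQ : 0 ≤ P * Q := mul_nonneg hp hq
  have hprod : (a ^ 2 + b ^ 2) * (x ^ 2 + y ^ 2) ≤ (P * Q) ^ 2 := by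
    calc _ ≤ P ^ 2 * Q ^ 2 := mul_le_mul p1 q1 (by positivity) (by positivity)
      _ = _ := by ring
  have e1 : |a * x + b * y| ≤ P * Q := abs_le_of_sq_le_sq (by nlinarith [sq_nonneg (a * y - b * x)]) hPQ
  have e2 : |a * y - x * b| ≤ P * Q := abs_le_of_sq_le_sq (by nlinarith [sq_nonneg (a * x + b * y)]) hPQ
  rw [abs_le] at *
  constructor
  · nlinarith
  · constructor <;> nlinarith

theorem dH_nonneg (p q : Hei) : 0 ≤ dH p q := Hnorm_nonneg _

theorem dH_symm (p q : Hei) : dH p q = dH q p := by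
  unfold dH Hnorm Hmul Hinv
  simp only
  congr 2
  · ring
  · rw [← abs_neg]; congr 1; ring

theorem dH_triangle (p q r : Hei) : dH p r ≤ dH p q + dH q r := by
  have h := Hnorm_mul_le (Hmul (Hinv r) q) (Hmul (Hinv q) p)
  have e : Hmul (Hmul (Hinv r) q) (Hmul (Hinv q) p) = Hmul (Hinv r) p := by
    unfold Hmul Hinv
    ext <;> simp only <;> ring
  rw [e] at h
  unfold dH
  linarith

/-- Left translation by `q⁻¹` followed by the rotation taking `u` to `(0,1)`. -/
noncomputable def Phi (u : ℝ × ℝ) (q p : Hei) : Hei :=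
  (u.2 * (p.1 - q.1) - u.1 * (p.2.1 - q.2.1), u.1 * (p.1 - q.1) + u.2 * (p.2.1 - q.2.1),
    p.2.2 - q.2.2 + (p.1 * q.2.1 - q.1 * p.2.1) / 2)

theorem dH_Phi (u : ℝ × ℝ) (hu : u.1 ^ 2 + u.2 ^ 2 = 1) (q p p' : Hei) :
    dH (Phi u q p) (Phi u q p') = dH p p' := by
  unfold dH Hnorm Hmul Hinv Phi
  simp only
  congr 2
  · linear_combination ((p.1 - p'.1) ^ 2 + (p.2.1 - p'.2.1) ^ 2) * hu
  · congr 1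
    linear_combination (((q.1 - p'.1) * (p.2.1 - q.2.1) - (q.2.1 - p'.2.1) * (p.1 - q.1)) / 2) * hu

theorem dH_line (p : Hei) (v : ℝ × ℝ) (hv : v.1 ^ 2 + v.2 ^ 2 = 1) (s s' : ℝ) :
    dH (Hmul p (s * v.1, s * v.2, 0)) (Hmul p (s' * v.1, s' * v.2, 0)) = |s - s'| := by
  have e : Hmul (Hinv (Hmul p (s' * v.1, s' * v.2, 0))) (Hmul p (s * v.1, s * v.2, 0))
      = ((s - s') * v.1, (s - s') * v.2, 0) := by
    unfold Hmul Hinv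
    ext <;> simp only <;> ring
  unfold dH
  rw [e]
  unfold Hnorm
  simp only [abs_zero, Real.sqrt_zero]
  rw [show ((s - s') * v.1) ^ 2 + ((s - s') * v.2) ^ 2 = (s - s') ^ 2 by
    linear_combination (s - s') ^ 2 * hv, Real.sqrt_sq_eq_abs]
  exact max_eq_left (abs_nonneg _)

theorem near_axis (x y t η D : ℝ) (hD : 0 ≤ D) (h : dH (x, y, t) (0, η, 0) ≤ D) :
    |x| ≤ D ∧ |t + x * y / 2| ≤ 3 / 2 * D ^ 2 := by
  unfold dH at h
  rw [Hnorm_le_iff _ _ hD] at h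
  simp only [Hmul, Hinv] at h
  obtain ⟨h1, h2⟩ := h
  have hx : |x| ≤ D := abs_le_of_sq_le_sq (by nlinarith [sq_nonneg (-η + y)]) hD
  have hy : |y - η| ≤ D := abs_le_of_sq_le_sq (by nlinarith [sq_nonneg (-0 + x)]) hD
  have hxy : |x * (y - η)| ≤ D * D := by
    rw [abs_mul]; exact mul_le_mul hx hy (abs_nonneg _) hD
  refine ⟨hx, ?_⟩
  rw [abs_le] at *
  constructor <;> nlinarith

/-- Two points control a quadratic vanishing at zero. -/
theorem quad_bound (A B E r T s s' : ℝ) (hr : 0 < r)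
    (hs : r ≤ |s|) (hs' : r ≤ |s'|) (hss : r ≤ |s - s'|) (hT : |s| ≤ T)
    (h : |s * A + s ^ 2 * B| ≤ E) (h' : |s' * A + s' ^ 2 * B| ≤ E) :
    |B| ≤ 2 * E / r ^ 2 ∧ |A| ≤ E / r + 2 * E * T / r ^ 2 := by
  have g : ∀ s, r ≤ |s| → |s * A + s ^ 2 * B| ≤ E → |A + s * B| ≤ E / r := by
    intro s hs h
    rw [le_div_iff₀ hr]
    calc |A + s * B| * r ≤ |A + s * B| * |s| := by gcongr
      _ = |s * A + s ^ 2 * B| := by rw [← abs_mul]; congr 1; ring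
      _ ≤ E := h
  have g1 := g s hs h
  have g2 := g s' hs' h'
  have hB : |B| ≤ 2 * E / r ^ 2 := by
    have : |B| * r ≤ 2 * (E / r) := by
      calc |B| * r ≤ |B| * |s - s'| := by gcongr
        _ = |(A + s * B) - (A + s' * B)| := by rw [← abs_mul]; congr 1; ring
        _ ≤ _ := by
          have := abs_sub (A + s * B) (A + s' * B)
          linarith
    rw [← le_div_iff₀ hr] at this
    refine this.trans (le_of_eq ?_)
    field_simp
  refine ⟨hB, ?_⟩
  have : |A| ≤ |A + s * B| + |s| * |B| := by
    calc |A| = |(A + s * B) - s * B| := by congr 1; ring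
      _ ≤ |A + s * B| + |s * B| := abs_sub _ _
      _ = _ := by rw [abs_mul]
  have h3 : |s| * |B| ≤ T * (2 * E / r ^ 2) := mul_le_mul hT hB (abs_nonneg _) ((abs_nonneg _).trans hT)
  calc |A| ≤ E / r + T * (2 * E / r ^ 2) := by linarith
    _ = _ := by ring

theorem key0 (p : Hei) (v : ℝ × ℝ) (hv : v.1 ^ 2 + v.2 ^ 2 = 1) (D r T s s' η₀ η η' : ℝ)
    (hD : 0 ≤ D) (hr : 0 < r) (hDr : 4 * D ≤ r)
    (hs : r ≤ |s|) (hs' : r ≤ |s'|) (hss : r ≤ |s - s'|) (hT : |s| ≤ T)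
    (h0 : dH p (0, η₀, 0) ≤ D)
    (h : dH (Hmul p (s * v.1, s * v.2, 0)) (0, η, 0) ≤ D)
    (h' : dH (Hmul p (s' * v.1, s' * v.2, 0)) (0, η', 0) ≤ D) :
    ∃ A B : ℝ, |B| ≤ 6 * D ^ 2 / r ^ 2 ∧ |A| ≤ 3 * D ^ 2 / r + 6 * D ^ 2 * T / r ^ 2 ∧
      ∃ c, ∀ σ, ∃ y, dH (Hmul p (σ * v.1, σ * v.2, 0)) (0, y, c) ≤
        max (2 * |A| + 4 * |σ| * |B|) (Real.sqrt (|σ| * |A| + σ ^ 2 * |B|)) := by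
  obtain ⟨x₀, y₀, t₀⟩ := p
  obtain ⟨a, b⟩ := v
  simp only [Hmul] at *
  obtain ⟨a0, b0⟩ := near_axis _ _ _ _ _ hD h0
  obtain ⟨a1, b1⟩ := near_axis _ _ _ _ _ hD h
  obtain ⟨a2, b2⟩ := near_axis _ _ _ _ _ hD h'
  have cg : ∀ s : ℝ, |t₀ + 0 + (x₀ * (s * b) - s * a * y₀) / 2 + (x₀ + s * a) * (y₀ + s * b) / 2|
      ≤ 3 / 2 * D ^ 2 → |s * (x₀ * b) + s ^ 2 * (a * b / 2)| ≤ 3 * D ^ 2 := by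
    intro s b1
    have e : s * (x₀ * b) + s ^ 2 * (a * b / 2) =
      (t₀ + 0 + (x₀ * (s * b) - s * a * y₀) / 2 + (x₀ + s * a) * (y₀ + s * b) / 2)
        - (t₀ + x₀ * y₀ / 2) := by ring
    rw [e]
    refine (abs_sub _ _).trans ?_
    linarith
  have c1 := cg s b1
  have c2 := cg s' b2
  obtain ⟨hB, hA⟩ := quad_bound _ _ _ r T s s' hr hs hs' hss hT c1 c2
  have ha : |a| ≤ 1 / 2 := by
    have e : |s| * |a| ≤ 2 * D := by
      rw [← abs_mul]
      rw [abs_le] at *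
      constructor <;> linarith
    have : r * |a| ≤ |s| * |a| := by gcongr
    by_contra hc
    push Not at hc
    have := mul_lt_mul_of_pos_left hc hr
    linarith
  have hb : 1 / 2 ≤ |b| := by
    have h1 : a ^ 2 ≤ 1 / 4 := by
      have := sq_abs a
      nlinarith [abs_nonneg a]
    by_contra hc
    push Not at hc
    have := sq_abs b
    nlinarith [abs_nonneg b]
  refine ⟨x₀ * b, a * b / 2, ?_, ?_, t₀ + x₀ * y₀ / 2, fun σ => ⟨y₀ + σ * b, ?_⟩⟩
  · refine hB.trans (le_of_eq (by ring))
  · refine hA.trans (le_of_eq (by ring))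
  have hx : |x₀ + σ * a| ≤ 2 * |x₀ * b| + 4 * |σ| * |a * b / 2| := by
    have e1 : |x₀ + σ * a| ≤ |x₀| + |σ| * |a| := by
      rw [← abs_mul]; exact abs_add_le _ _
    have e2 : |x₀| ≤ 2 * |x₀ * b| := by
      rw [abs_mul]
      have := mul_le_mul_of_nonneg_left hb (abs_nonneg x₀)
      linarith
    have e3 : |a| ≤ 4 * |a * b / 2| := by
      rw [abs_div, abs_mul, abs_two]
      have := mul_le_mul_of_nonneg_left hb (abs_nonneg a)
      linarith
    have e4 : |σ| * |a| ≤ |σ| * (4 * |a * b / 2|) := by gcongr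
    linarith
  unfold dH Hnorm
  apply max_le_max
  · simp only [Hmul, Hinv]
    rw [Real.sqrt_le_left (by positivity)]
    have := sq_le_sq' (by linarith [neg_abs_le (x₀ + σ * a), abs_le.1 hx]) ((le_abs_self _).trans hx)
    linarith
  · simp only [Hmul, Hinv]
    apply Real.sqrt_le_sqrt
    calc _ = |σ * (x₀ * b) + σ ^ 2 * (a * b / 2)| := by congr 1; ring
      _ ≤ |σ * (x₀ * b)| + |σ ^ 2 * (a * b / 2)| := abs_add_le _ _
      _ = _ := by rw [abs_mul, abs_mul (σ ^ 2), abs_of_nonneg (sq_nonneg σ)]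

theorem key1 (q : Hei) (u : ℝ × ℝ) (hu : u.1 ^ 2 + u.2 ^ 2 = 1)
    (p : Hei) (v : ℝ × ℝ) (hv : v.1 ^ 2 + v.2 ^ 2 = 1) (D r T s s' η₀ η η' : ℝ)
    (hD : 0 ≤ D) (hr : 0 < r) (hDr : 4 * D ≤ r)
    (hs : r ≤ |s|) (hs' : r ≤ |s'|) (hss : r ≤ |s - s'|) (hT : |s| ≤ T)
    (h0 : dH p (Hmul q (η₀ * u.1, η₀ * u.2, 0)) ≤ D)
    (h : dH (Hmul p (s * v.1, s * v.2, 0)) (Hmul q (η * u.1, η * u.2, 0)) ≤ D)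
    (h' : dH (Hmul p (s' * v.1, s' * v.2, 0)) (Hmul q (η' * u.1, η' * u.2, 0)) ≤ D) :
    ∃ A B : ℝ, |B| ≤ 6 * D ^ 2 / r ^ 2 ∧ |A| ≤ 3 * D ^ 2 / r + 6 * D ^ 2 * T / r ^ 2 ∧
      ∃ c, ∀ σ, ∃ y, dH (Hmul p (σ * v.1, σ * v.2, 0))
          (Hmul (q.1, q.2.1, q.2.2 + c) (y * u.1, y * u.2, 0)) ≤
        max (2 * |A| + 4 * |σ| * |B|) (Real.sqrt (|σ| * |A| + σ ^ 2 * |B|)) := by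
  have E1 : ∀ y c : ℝ, Phi u q (Hmul (q.1, q.2.1, q.2.2 + c) (y * u.1, y * u.2, 0)) = (0, y, c) := by
    intro y c
    unfold Phi Hmul
    ext <;> simp only
    · ring
    · linear_combination y * hu
    · ring
  have E1' : ∀ y : ℝ, Phi u q (Hmul q (y * u.1, y * u.2, 0)) = (0, y, 0) := by
    intro y
    have := E1 y 0
    simpa using this
  have E2 : ∀ σ : ℝ, Phi u q (Hmul p (σ * v.1, σ * v.2, 0)) =
      Hmul (Phi u q p) (σ * (u.2 * v.1 - u.1 * v.2), σ * (u.1 * v.1 + u.2 * v.2), 0) := by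
    intro σ
    unfold Phi Hmul
    ext <;> simp only
    · ring
    · ring
    · linear_combination (-σ / 2 * ((p.1 - q.1) * v.2 - v.1 * (p.2.1 - q.2.1))) * hu
  rw [← dH_Phi u hu q, E1'] at h0
  rw [← dH_Phi u hu q, E1', E2] at h h'
  obtain ⟨A, B, hB, hA, c, hc⟩ := key0 (Phi u q p) (u.2 * v.1 - u.1 * v.2, u.1 * v.1 + u.2 * v.2)
    (by simp only; linear_combination (v.1 ^ 2 + v.2 ^ 2) * hu + hv)
    D r T s s' η₀ η η' hD hr hDr hs hs' hss hT h0 h h'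
  refine ⟨A, B, hB, hA, c, fun σ => ?_⟩
  obtain ⟨y, hy⟩ := hc σ
  refine ⟨y, ?_⟩
  rw [← dH_Phi u hu q, E1, E2]
  exact hy

theorem NH_elim {p : Hei} {E : Set Hei} {δ δ' : ℝ} (hE : E.Nonempty) (h : p ∈ NH E δ)
    (hd : δ < δ') : ∃ q ∈ E, dH p q ≤ δ' := by
  have h1 : sInf ((dH p) '' E) < δ' := lt_of_le_of_lt h hd
  obtain ⟨_, ⟨q, hq, rfl⟩, hlt⟩ := exists_lt_of_csInf_lt (hE.image _) h1
  exact ⟨q, hq, hlt.le⟩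

theorem NH_intro {p q : Hei} {E : Set Hei} {δ : ℝ} (hq : q ∈ E) (h : dH p q ≤ δ) : p ∈ NH E δ := by
  have hb : BddBelow ((dH p) '' E) := by
    refine ⟨0, ?_⟩
    rintro _ ⟨z, _, rfl⟩
    exact dH_nonneg _ _
  exact (csInf_le hb ⟨q, hq, rfl⟩).trans h

/-- A horizontal line can be based at any of its points, with unit direction. -/
theorem line_unit {L : Set Hei} (hL : IsHorizontalLine L) :
    L.Nonempty ∧ ∃ v : ℝ × ℝ, v.1 ^ 2 + v.2 ^ 2 = 1 ∧
      ∀ p ∈ L, ∀ q ∈ L, ∃ s : ℝ, q = Hmul p (s * v.1, s * v.2, 0) := by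
  obtain ⟨p, w, hw, rfl⟩ := hL
  refine ⟨⟨_, 0, rfl⟩, ?_⟩
  have hn : 0 < w.1 ^ 2 + w.2 ^ 2 := by
    by_contra hc
    apply hw
    have h1 : w.1 = 0 := by nlinarith [sq_nonneg w.1, sq_nonneg w.2]
    have h2 : w.2 = 0 := by nlinarith [sq_nonneg w.1, sq_nonneg w.2]
    exact Prod.ext h1 h2
  set n := Real.sqrt (w.1 ^ 2 + w.2 ^ 2) with hnd
  have hn0 : 0 < n := Real.sqrt_pos.2 hn
  have hnn : n ^ 2 = w.1 ^ 2 + w.2 ^ 2 := Real.sq_sqrt hn.le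
  refine ⟨(w.1 / n, w.2 / n), ?_, ?_⟩
  · simp only
    field_simp
    exact hnn.symm
  · rintro _ ⟨s, rfl⟩ _ ⟨s', rfl⟩
    refine ⟨(s' - s) * n, ?_⟩
    have e1 : (s' - s) * n * (w.1 / n) = (s' - s) * w.1 := by field_simp
    have e2 : (s' - s) * n * (w.2 / n) = (s' - s) * w.2 := by field_simp
    simp only [e1, e2]
    unfold Hmul
    ext <;> simp only <;> ring

theorem num_bound (M H ε l C A B σ : ℝ) (hM : 1 ≤ M) (hH : 1 ≤ H) (hε : 0 < ε) (hε1 : ε < 1)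
    (hl : 0 < l) (hC : C = 40000 * M ^ 6 * H ^ 2 / ε ^ 2) (hA0 : 0 ≤ A) (hB0 : 0 ≤ B)
    (hσ0 : 0 ≤ σ) (hσ : σ ≤ 2 * M * H * l)
    (hB : B ≤ 6 * (3 * M * H * l) ^ 2 / (C * H * l / (2 * M)) ^ 2)
    (hA : A ≤ 3 * (3 * M * H * l) ^ 2 / (C * H * l / (2 * M)) +
      6 * (3 * M * H * l) ^ 2 * (3 * M * (C * H * l)) / (C * H * l / (2 * M)) ^ 2) :
    2 * A + 4 * σ * B ≤ ε * l / 4 ∧ σ * A + σ ^ 2 * B ≤ (ε * l / 4) ^ 2 := by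
  have hM0 : 0 < M := by linarith
  have hH0 : 0 < H := by linarith
  have hMH : 1 ≤ M * H := one_le_mul_of_one_le_of_one_le hM hH
  have hA1 : A * (M * H) ≤ 702 / 40000 * ε ^ 2 * l := by
    have e : 3 * (3 * M * H * l) ^ 2 / (C * H * l / (2 * M)) +
      6 * (3 * M * H * l) ^ 2 * (3 * M * (C * H * l)) / (C * H * l / (2 * M)) ^ 2
      = (54 * M ^ 3 + 648 * M ^ 5) * (ε ^ 2 * l / (40000 * M ^ 6 * H)) := by
      subst hC
      field_simp
      ring
    rw [e] at hA
    have h35 : M ^ 3 ≤ M ^ 5 := pow_le_pow_right₀ hM (by norm_num)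
    have hA' : A ≤ (702 * M ^ 5) * (ε ^ 2 * l / (40000 * M ^ 6 * H)) :=
      hA.trans (mul_le_mul_of_nonneg_right (by linarith) (by positivity))
    calc A * (M * H) ≤ (702 * M ^ 5) * (ε ^ 2 * l / (40000 * M ^ 6 * H)) * (M * H) := by gcongr
      _ = _ := by field_simp
  have hB1 : B * (M * H) ^ 2 ≤ 1 / 1000000 * ε ^ 2 := by
    have e : 6 * (3 * M * H * l) ^ 2 / (C * H * l / (2 * M)) ^ 2 * (M * H) ^ 2
      = 216 / 1600000000 * ε ^ 2 * (ε ^ 2 / (M ^ 6 * H ^ 2)) := by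
      subst hC
      field_simp
      ring
    have h1 : ε ^ 2 / (M ^ 6 * H ^ 2) ≤ 1 := by
      rw [div_le_one (by positivity)]
      have : 1 ≤ M ^ 6 * H ^ 2 :=
        one_le_mul_of_one_le_of_one_le (one_le_pow₀ hM) (one_le_pow₀ hH)
      nlinarith
    calc B * (M * H) ^ 2 ≤ 6 * (3 * M * H * l) ^ 2 / (C * H * l / (2 * M)) ^ 2 * (M * H) ^ 2 := by
          gcongr
      _ = 216 / 1600000000 * ε ^ 2 * (ε ^ 2 / (M ^ 6 * H ^ 2)) := e
      _ ≤ 216 / 1600000000 * ε ^ 2 * 1 := by gcongr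
      _ ≤ _ := by nlinarith [sq_nonneg ε]
  have hee : ε ^ 2 ≤ ε := by nlinarith
  have hA2 : A ≤ 702 / 40000 * ε ^ 2 * l := (le_mul_of_one_le_right hA0 hMH).trans hA1
  have hσB : σ * B ≤ 2 * l * (1 / 1000000 * ε ^ 2) := by
    calc σ * B ≤ 2 * M * H * l * B := by gcongr
      _ = 2 * l * (B * (M * H)) := by ring
      _ ≤ 2 * l * (B * (M * H) ^ 2) := by
        have : M * H ≤ (M * H) ^ 2 := by nlinarith
        gcongr
      _ ≤ _ := by gcongr
  have hσA : σ * A ≤ 2 * l * (702 / 40000 * ε ^ 2 * l) := by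
    calc σ * A ≤ 2 * M * H * l * A := by gcongr
      _ = 2 * l * (A * (M * H)) := by ring
      _ ≤ _ := by gcongr
  have hσ2B : σ ^ 2 * B ≤ 4 * l ^ 2 * (1 / 1000000 * ε ^ 2) := by
    calc σ ^ 2 * B ≤ (2 * M * H * l) ^ 2 * B := by gcongr
      _ = 4 * l ^ 2 * (B * (M * H) ^ 2) := by ring
      _ ≤ _ := by gcongr
  have hel : ε ^ 2 * l ≤ ε * l := by gcongr
  have hel0 : 0 < ε * l := by positivity
  constructor
  · nlinarith
  · have : 0 < ε ^ 2 * l ^ 2 := by positivity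
    nlinarith

theorem dPar_horiz (y y' t : ℝ) : dPar (y, t) (y', t) = |y - y'| := by
  unfold dPar
  simp

theorem dPar_vert (y t t' : ℝ) : dPar (y, t) (y, t') = Real.sqrt |t - t'| := by
  unfold dPar
  simp

set_option maxHeartbeats 2000000 in
/-- **Corollary 3.11.** Ruled rectangles are vertical rectangles. -/
theorem ruled_implies_vertical :
    ∀ M : ℝ, 1 ≤ M → ∀ ε : ℝ, 0 < ε → ε < 1 → ∀ Hc : ℝ, 1 ≤ Hc →
      ∃ C₀ : ℝ, 10 ≤ C₀ ∧ ∃ δ₀ > (0 : ℝ),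
        ∀ S > (0 : ℝ), ∀ f : ℝ × ℝ → Hei, IsBilipschitz M f →
          ∀ C ≥ C₀, ∀ δ : ℝ, 0 < δ → δ ≤ δ₀ →
            ∀ i : Idx, IsRuledSlope f δ (C * Hc) S i → IsVerticalRect f ε Hc S i := by
  intro M hM ε hε hε1 H hH
  have hM0 : 0 < M := by linarith
  have hH0 : 0 < H := by linarith
  have hC40 : 40000 * M ^ 2 ≤ 40000 * M ^ 6 * H ^ 2 / ε ^ 2 := by
    rw [le_div_iff₀ (by positivity)]
    have h1 : M ^ 2 ≤ M ^ 6 := pow_le_pow_right₀ hM (by norm_num)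
    have h2 : ε ^ 2 ≤ 1 := pow_le_one₀ hε.le hε1.le
    have h3 : 1 ≤ H ^ 2 := one_le_pow₀ hH
    calc 40000 * M ^ 2 * ε ^ 2 ≤ 40000 * M ^ 6 * 1 := by gcongr
      _ ≤ 40000 * M ^ 6 * H ^ 2 := by gcongr
  have hM2 : 1 ≤ M ^ 2 := one_le_pow₀ hM
  obtain ⟨C₀, hC₀⟩ : ∃ C₀, C₀ = 40000 * M ^ 6 * H ^ 2 / ε ^ 2 := ⟨_, rfl⟩
  rw [← hC₀] at hC40
  have hC1 : 1 ≤ C₀ := by linarith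
  refine ⟨C₀, by linarith, ε / 8, by positivity, ?_⟩
  intro S _ f hf C hC δ hδ hδ0 i hruled
  obtain ⟨hR, t₀, ⟨w, hw1, hw2⟩, L₀, ⟨a, b, c, haS, rfl⟩, hL₀⟩ := hruled
  have hl : 0 < sideLen i := by unfold sideLen; positivity
  have hct : |t₀ - (center i).2| ≤ sideLen i ^ 2 := by
    have h4 : (4 : ℝ) ^ (-i.1) = sideLen i ^ 2 := by
      unfold sideLen
      rw [show (4 : ℝ) = 2 ^ 2 by norm_num, ← zpow_natCast, ← zpow_natCast, ← zpow_mul, ← zpow_mul,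
        mul_comm]
    have h5 := hw2.2
    have h6 : w.2 = t₀ := hw1
    rw [h6, h4] at h5
    obtain ⟨h7, h8⟩ := h5
    have h9 : (center i).2 = ((i.2.2 : ℝ) + 1 / 2) * sideLen i ^ 2 := by
      unfold center
      simp only [h4]
    rw [h9, abs_le]
    have := sq_nonneg (sideLen i)
    constructor <;> nlinarith
  have hdil : ∀ y t : ℝ, |y - (center i).1| ≤ C₀ * H * sideLen i →
      |t - (center i).2| ≤ (H * sideLen i) ^ 2 → (y, t) ∈ dilate (C * H) i := by
    intro y t hy ht
    have hCH : C₀ * H * sideLen i ≤ C * H * sideLen i := by gcongr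
    have hCH' : H * sideLen i ≤ C * H * sideLen i := by
      have : 1 ≤ C := hC1.trans hC
      have : 1 * (H * sideLen i) ≤ C * (H * sideLen i) := by gcongr
      linarith
    refine max_le (hy.trans hCH) ?_
    refine (Real.sqrt_le_left (by nlinarith [mul_pos hH0 hl])).2 (ht.trans ?_)
    gcongr
  generalize hcy : (center i).1 = cy at *
  generalize hctt : (center i).2 = ct at *
  generalize hll : sideLen i = l at *
  have hll1 : l ^ 2 ≤ (H * l) ^ 2 := by
    have : 1 * l ≤ H * l := by gcongr
    have : l ≤ H * l := by linarith
    gcongr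
  refine ⟨{p : Hei | p.1 = a * p.2.1 + b}, ⟨a, b, haS, rfl⟩, ?_⟩
  refine lt_of_le_of_lt (b := ε / (2 * H)) (csInf_le ⟨0, fun x hx => hx.1.le⟩ ?_)
    (div_lt_div_of_pos_left hε hH0 (by linarith))
  refine ⟨by positivity, fun t => ?_⟩
  have heps : ε / (2 * H) * (H * sideLen i) = ε * l / 2 := by
    rw [hll]; field_simp
  rw [heps]
  -- unit direction of the reference line
  have hn : 0 < 1 + a ^ 2 := by positivity
  obtain ⟨n, hn0, hnn⟩ : ∃ n : ℝ, 0 < n ∧ n ^ 2 = 1 + a ^ 2 :=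
    ⟨Real.sqrt (1 + a ^ 2), Real.sqrt_pos.2 hn, Real.sq_sqrt hn.le⟩
  obtain ⟨u, hudef⟩ : ∃ u : ℝ × ℝ, u = (a / n, 1 / n) := ⟨_, rfl⟩
  have hu1 : u.1 = a * u.2 := by rw [hudef]; simp only; ring
  have hu : u.1 ^ 2 + u.2 ^ 2 = 1 := by
    rw [hudef]; simp only; field_simp; linarith
  have hu0 : u ≠ 0 := by
    rintro rfl
    simp at hu
  have hline_par : ∀ c' : ℝ, IsHorizontalLine {q | ∃ s : ℝ, q = Hmul (b, 0, c') (s * u.1, s * u.2, 0)} ∧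
      {q | ∃ s : ℝ, q = Hmul (b, 0, c') (s * u.1, s * u.2, 0)} ⊆ {p : Hei | p.1 = a * p.2.1 + b} := by
    intro c'
    refine ⟨⟨_, u, hu0, rfl⟩, ?_⟩
    rintro _ ⟨s, rfl⟩
    simp only [Hmul, Set.mem_ofPred_eq]
    rw [hu1]; ring
  by_cases ht : |t - ct| ≤ (H * l) ^ 2
  swap
  · refine ⟨_, (hline_par 0).1, (hline_par 0).2, ?_⟩
    rintro _ ⟨z, ⟨hz1, hz2⟩, rfl⟩
    exfalso
    apply ht
    have h1 : Real.sqrt |z.2 - (center i).2| ≤ H * sideLen i := (le_max_right _ _).trans hz2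
    rw [hctt, hll, Real.sqrt_le_left (by positivity)] at h1
    have h2 : z.2 = t := hz1
    rwa [h2] at h1
  obtain ⟨L, hL, hLt⟩ := hR t
  rw [hll] at hLt
  obtain ⟨hLne, v, hv, hLv⟩ := line_unit hL
  have hδl : δ * l < 2 * δ * l := by nlinarith [mul_pos hδ hl]
  have hδl4 : 4 * δ * l ≤ ε * l / 2 := by
    have : 4 * δ ≤ ε / 2 := by linarith
    calc 4 * δ * l ≤ ε / 2 * l := by gcongr
      _ = _ := by ring
  have hεl : ε * l ≤ l := by nlinarith
  -- points on the reference line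
  have hq : ∀ y, |y - cy| ≤ C₀ * H * l →
      ∃ η : ℝ, dH (f (y, t₀)) (Hmul (b, 0, c) (η * u.1, η * u.2, 0)) ≤ 2 * δ * l := by
    intro y hy
    have hmem := hL₀ ⟨(y, t₀), ⟨rfl, hdil y t₀ hy (hct.trans hll1)⟩, rfl⟩
    obtain ⟨_, ⟨y', rfl⟩, hd⟩ := NH_elim (E := hline a b c) ⟨_, 0, rfl⟩ hmem hδl
    refine ⟨y' * n, ?_⟩
    have e : Hmul (b, 0, c) (y' * n * u.1, y' * n * u.2, 0) = (a * y' + b, y', b * y' / 2 + c) := by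
      rw [hudef]
      unfold Hmul
      ext <;> simp only <;> field_simp <;> ring
    rw [e]
    exact hd
  have hp : ∀ y, |y - cy| ≤ C₀ * H * l → ∃ p ∈ L, dH (f (y, t)) p ≤ 2 * δ * l := by
    intro y hy
    exact NH_elim hLne (hLt ⟨(y, t), ⟨rfl, hdil y t hy ht⟩, rfl⟩) hδl
  have hRpos : 0 < C₀ * H * l := by positivity
  obtain ⟨p, hpL, hp0⟩ := hp cy (by simpa using hRpos.le)
  have hps : ∀ y, |y - cy| ≤ C₀ * H * l →
      ∃ s : ℝ, dH (f (y, t)) (Hmul p (s * v.1, s * v.2, 0)) ≤ 2 * δ * l := by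
    intro y hy
    obtain ⟨p', hp', hd⟩ := hp y hy
    obtain ⟨s, rfl⟩ := hLv p hpL p' hp'
    exact ⟨s, hd⟩
  have hp00 : Hmul p ((0 : ℝ) * v.1, (0 : ℝ) * v.2, 0) = p := by
    unfold Hmul
    ext <;> simp
  -- comparison of parameters
  have hcomp : ∀ y y' s s' : ℝ, dH (f (y, t)) (Hmul p (s * v.1, s * v.2, 0)) ≤ 2 * δ * l →
      dH (f (y', t)) (Hmul p (s' * v.1, s' * v.2, 0)) ≤ 2 * δ * l →
      M⁻¹ * |y - y'| - l / 2 ≤ |s - s'| ∧ |s - s'| ≤ M * |y - y'| + l / 2 := by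
    intro y y' s s' h1 h2
    have hb := hf (y, t) (y', t)
    rw [dPar_horiz] at hb
    rw [← dH_line p v hv s s']
    have k1 := dH_triangle (f (y, t)) (Hmul p (s * v.1, s * v.2, 0)) (f (y', t))
    have k2 := dH_triangle (Hmul p (s * v.1, s * v.2, 0)) (Hmul p (s' * v.1, s' * v.2, 0)) (f (y', t))
    have k3 := dH_triangle (Hmul p (s * v.1, s * v.2, 0)) (f (y, t)) (Hmul p (s' * v.1, s' * v.2, 0))
    have k4 := dH_triangle (f (y, t)) (f (y', t)) (Hmul p (s' * v.1, s' * v.2, 0))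
    rw [dH_symm (Hmul p (s * v.1, s * v.2, 0)) (f (y, t))] at k3
    rw [dH_symm (Hmul p (s' * v.1, s' * v.2, 0)) (f (y', t))] at k2
    constructor
    · linarith [hb.1]
    · linarith [hb.2]
  have hMHl : l ≤ M * H * l := by
    have : 1 ≤ M * H := one_le_mul_of_one_le_of_one_le hM hH
    nlinarith
  have hD : ∀ y s η : ℝ, dH (f (y, t)) (Hmul p (s * v.1, s * v.2, 0)) ≤ 2 * δ * l →
      dH (f (y, t₀)) (Hmul (b, 0, c) (η * u.1, η * u.2, 0)) ≤ 2 * δ * l →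
      dH (Hmul p (s * v.1, s * v.2, 0)) (Hmul (b, 0, c) (η * u.1, η * u.2, 0)) ≤ 3 * M * H * l := by
    intro y s η h1 h2
    have hb := (hf (y, t) (y, t₀)).2
    rw [dPar_vert] at hb
    have hs : Real.sqrt |t - t₀| ≤ 2 * (H * l) := by
      rw [Real.sqrt_le_left (by positivity)]
      have := abs_sub_le t ct t₀
      rw [abs_sub_comm ct t₀] at this
      have e : (2 * (H * l)) ^ 2 = 4 * (H * l) ^ 2 := by ring
      have := sq_nonneg (H * l)
      linarith
    have hs' : M * Real.sqrt |t - t₀| ≤ M * (2 * (H * l)) := by gcongr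
    have k1 := dH_triangle (Hmul p (s * v.1, s * v.2, 0)) (f (y, t)) (Hmul (b, 0, c) (η * u.1, η * u.2, 0))
    have k2 := dH_triangle (f (y, t)) (f (y, t₀)) (Hmul (b, 0, c) (η * u.1, η * u.2, 0))
    rw [dH_symm _ (f (y, t))] at k1
    linarith
  have y0 : |cy - cy| ≤ C₀ * H * l := by simpa using hRpos.le
  have y1 : |cy + C₀ * H * l - cy| ≤ C₀ * H * l := by
    rw [add_sub_cancel_left, abs_of_pos hRpos]
  have y2 : |cy - C₀ * H * l - cy| ≤ C₀ * H * l := by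
    rw [sub_sub_cancel_left, abs_neg, abs_of_pos hRpos]
  obtain ⟨η₀, hη₀⟩ := hq _ y0
  obtain ⟨η₁, hη₁⟩ := hq _ y1
  obtain ⟨η₂, hη₂⟩ := hq _ y2
  obtain ⟨s₁, hs₁⟩ := hps _ y1
  obtain ⟨s₂, hs₂⟩ := hps _ y2
  have hs₀ : dH (f (cy, t)) (Hmul p ((0 : ℝ) * v.1, (0 : ℝ) * v.2, 0)) ≤ 2 * δ * l := by
    rw [hp00]; exact hp0
  have hr : 12 * (M * H * l) ≤ C₀ * H * l / (2 * M) := by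
    rw [le_div_iff₀ (by positivity)]
    calc 12 * (M * H * l) * (2 * M) = (24 * M ^ 2) * (H * l) := by ring
      _ ≤ C₀ * (H * l) := by gcongr; linarith
      _ = _ := by ring
  have hrM : M⁻¹ * (C₀ * H * l) = 2 * (C₀ * H * l / (2 * M)) := by field_simp
  have hrpos : 0 < C₀ * H * l / (2 * M) := by positivity
  have m1 := hcomp _ _ _ _ hs₁ hs₀
  have m2 := hcomp _ _ _ _ hs₂ hs₀
  have m3 := hcomp _ _ _ _ hs₁ hs₂
  rw [add_sub_cancel_left, abs_of_pos hRpos, hrM, sub_zero] at m1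
  rw [sub_sub_cancel_left, abs_neg, abs_of_pos hRpos, hrM, sub_zero] at m2
  rw [show cy + C₀ * H * l - (cy - C₀ * H * l) = 2 * (C₀ * H * l) by ring,
    abs_of_pos (by positivity), mul_left_comm, hrM] at m3
  have hMR : l ≤ M * (C₀ * H * l) := by
    have : 1 * (M * H * l) ≤ C₀ * (M * H * l) := by gcongr
    nlinarith
  obtain ⟨A, B, hB, hA, c', hc'⟩ := key1 (b, 0, c) u hu p v hv (3 * M * H * l)
    (C₀ * H * l / (2 * M)) (3 * M * (C₀ * H * l)) s₁ s₂ η₀ η₁ η₂ (by positivity) hrpos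
    (by linarith) (by linarith [m1.1]) (by linarith [m2.1]) (by linarith [m3.1])
    (by linarith [m1.2])
    (by have := hD _ _ _ hs₀ hη₀
        rwa [hp00] at this)
    (hD _ _ _ hs₁ hη₁) (hD _ _ _ hs₂ hη₂)
  refine ⟨_, (hline_par (c + c')).1, (hline_par (c + c')).2, ?_⟩
  rintro _ ⟨⟨y, t'⟩, ⟨hz1, hz2⟩, rfl⟩
  obtain rfl : t' = t := hz1
  have hyH : |y - cy| ≤ H * l := by
    have : |y - (center i).1| ≤ H * sideLen i := (le_max_left _ _).trans hz2
    rwa [hcy, hll] at this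
  have hyR : |y - cy| ≤ C₀ * H * l := by
    have : 1 * (H * l) ≤ C₀ * (H * l) := by gcongr
    linarith
  obtain ⟨σ, hσ⟩ := hps y hyR
  have m4 := (hcomp _ _ _ _ hσ hs₀).2
  rw [sub_zero] at m4
  have hσ2 : |σ| ≤ 2 * M * H * l := by
    have : M * |y - cy| ≤ M * (H * l) := by gcongr
    linarith
  obtain ⟨n1, n2⟩ := num_bound M H ε l C₀ |A| |B| |σ| hM hH hε hε1 hl hC₀ (abs_nonneg _)
    (abs_nonneg _) (abs_nonneg _) hσ2 hB hA
  obtain ⟨z, hz⟩ := hc' σ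
  refine NH_intro ⟨z, rfl⟩ ?_
  refine (dH_triangle _ (Hmul p (σ * v.1, σ * v.2, 0)) _).trans ?_
  have hmax : max (2 * |A| + 4 * |σ| * |B|) (Real.sqrt (|σ| * |A| + σ ^ 2 * |B|)) ≤ ε * l / 4 := by
    refine max_le n1 ?_
    rw [Real.sqrt_le_left (by positivity), ← sq_abs σ]
    exact n2
  have := hz.trans hmax
  simp only at this
  linarith

end HeisRug
end

section
/- (Lemma 2.2) There exists an absolute constant A ≥ 10 such that the following holds. Let 0 < ε < 1, H ≥ 1, let L₁, L₂ ⊂ ℍ be horizontal lines, let p ∈ L₁, and let r > 0. Assume that B(p, AH³ε⁻²r) ∩ L₂ ⊂ N(L₁, Hr). Then there exists a horizontal line L contained in the vertical plane 𝕍(L₁) spanned by L₁ such that B(p, Hr) ∩ L₂ ⊂ N(L, εr). -/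
open scoped ENNReal

namespace HeisRug

/-- Numerical core: bounds on the coefficients. -/
theorem core_coef {a b c α β h S : ℝ} (hw : α ^ 2 + β ^ 2 = 1) (hh : 0 < h) (hS : 50 * h ≤ S)
    (hab : a ^ 2 + b ^ 2 ≤ h ^ 2) (hc : |c| ≤ h ^ 2)
    (hyp : ∀ s : ℝ, |s| ≤ S → ∃ u : ℝ,
      (a + s * α - u) ^ 2 + (b + s * β) ^ 2 ≤ (2 * h) ^ 2 ∧
      |c + s * (a * β - b * α) / 2 - u * (b + s * β) / 2| ≤ (2 * h) ^ 2) :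
    S * |b| ≤ 12 * h ^ 2 ∧ S ^ 2 * |β| ≤ 30 * h ^ 2 := by
  have hS0 : 0 < S := by linarith
  have key : ∀ s : ℝ, |s| ≤ S → |b + s * β| ≤ 2 * h ∧
      |c - a * b / 2 - s * (α * b) - s ^ 2 * (α * β) / 2| ≤ 6 * h ^ 2 := by
    intro s hs
    obtain ⟨u, h1, h2⟩ := hyp s hs
    have hy : |b + s * β| ≤ 2 * h := abs_le_of_sq_le_sq (by nlinarith [sq_nonneg (a + s * α - u)]) (by linarith)
    have hx : |a + s * α - u| ≤ 2 * h := abs_le_of_sq_le_sq (by nlinarith [sq_nonneg (b + s * β)]) (by linarith)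
    refine ⟨hy, ?_⟩
    have hm : |(a + s * α - u) * (b + s * β)| ≤ (2 * h) * (2 * h) := by
      rw [abs_mul]; gcongr
    have e : c - a * b / 2 - s * (α * b) - s ^ 2 * (α * β) / 2 =
      (c + s * (a * β - b * α) / 2 - u * (b + s * β) / 2) - (a + s * α - u) * (b + s * β) / 2 := by ring
    rw [e]
    rw [abs_le] at *
    constructor <;> nlinarith
  obtain ⟨p1, p2⟩ := key S (by rw [abs_of_pos hS0])
  obtain ⟨m1, m2⟩ := key (-S) (by rw [abs_neg, abs_of_pos hS0])
  have hβ : S * |β| ≤ 2 * h := by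
    rw [← abs_of_pos hS0, ← abs_mul]
    rw [abs_le] at *
    constructor <;> linarith
  have hβ' : |β| ≤ 1 / 25 := by
    by_contra hcon
    push Not at hcon
    nlinarith
  have hα : 1 / 2 ≤ |α| := by
    have : |β| ^ 2 ≤ (1 / 25) ^ 2 := by gcongr
    rw [sq_abs] at this
    have h3 : (1 / 2 : ℝ) ^ 2 ≤ |α| ^ 2 := by rw [sq_abs]; linarith
    exact le_of_sq_le_sq h3 (abs_nonneg _)
  have hab2 : |a * b| ≤ h ^ 2 := by
    rw [abs_le]; constructor <;> nlinarith [sq_nonneg (a - b), sq_nonneg (a + b)]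
  have q1 : S * |α * b| ≤ 6 * h ^ 2 := by
    rw [← abs_of_pos hS0, ← abs_mul]
    rw [abs_le] at *
    constructor <;> linarith
  have q2 : S ^ 2 * |α * β| ≤ 15 * h ^ 2 := by
    rw [← abs_of_pos (pow_pos hS0 2), ← abs_mul]
    rw [abs_le] at *
    constructor <;> linarith
  rw [abs_mul] at q1 q2
  constructor
  · have := mul_le_mul_of_nonneg_left hα (mul_nonneg hS0.le (abs_nonneg b))
    linarith
  · have := mul_le_mul_of_nonneg_left hα (mul_nonneg (pow_pos hS0 2).le (abs_nonneg β))
    linarith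

set_option maxHeartbeats 2000000 in
theorem core {a b c α β H ε r : ℝ} (hw : α ^ 2 + β ^ 2 = 1) (hH : 1 ≤ H) (hε : 0 < ε) (hε1 : ε < 1)
    (hr : 0 < r) (hab : a ^ 2 + b ^ 2 ≤ (H * r) ^ 2) (hc : |c| ≤ (H * r) ^ 2)
    (hyp : ∀ s : ℝ, (a + s * α) ^ 2 + (b + s * β) ^ 2 ≤ (100 * H ^ 3 / ε ^ 2 * r) ^ 2 →
      |c + s * (a * β - b * α) / 2| ≤ (100 * H ^ 3 / ε ^ 2 * r) ^ 2 → ∃ u : ℝ,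
      (a + s * α - u) ^ 2 + (b + s * β) ^ 2 ≤ (2 * (H * r)) ^ 2 ∧
      |c + s * (a * β - b * α) / 2 - u * (b + s * β) / 2| ≤ (2 * (H * r)) ^ 2)
    (s : ℝ) (hs : (a + s * α) ^ 2 + (b + s * β) ^ 2 ≤ (H * r) ^ 2) :
    (b + s * β) ^ 2 ≤ (ε * r) ^ 2 ∧
    |c + s * (a * β - b * α) / 2 - (c - a * b / 2) - (a + s * α) * (b + s * β) / 2| ≤ (ε * r) ^ 2 := by
  obtain ⟨h, hh⟩ : ∃ h, h = H * r := ⟨_, rfl⟩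
  obtain ⟨S, hSd⟩ : ∃ S, S = 50 * H ^ 3 / ε ^ 2 * r := ⟨_, rfl⟩
  have hSe : S * ε ^ 2 = 50 * h * H ^ 2 := by rw [hSd, hh]; field_simp
  have hR : 100 * H ^ 3 / ε ^ 2 * r = 2 * S := by rw [hSd]; ring
  rw [hR] at hyp
  rw [← hh] at hyp hab hc hs
  have h0 : 0 < h := by rw [hh]; positivity
  have hS0 : 0 < S := by rw [hSd]; positivity
  have hε2 : ε ^ 2 ≤ 1 := by nlinarith
  have hH2 : 1 ≤ H ^ 2 := by nlinarith
  have hS : 50 * h ≤ S := by nlinarith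
  have cs : ∀ x y : ℝ, (x * α + y * β) ^ 2 + (x * β - y * α) ^ 2 = x ^ 2 + y ^ 2 := by
    intro x y
    calc _ = (x ^ 2 + y ^ 2) * (α ^ 2 + β ^ 2) := by ring
      _ = _ := by rw [hw, mul_one]
  have csab := cs a b
  obtain ⟨k1, k2⟩ := core_coef hw h0 hS hab hc (by
    intro s hs
    have e1 : |a * α + b * β| ≤ h := abs_le_of_sq_le_sq (by nlinarith [sq_nonneg (a * β - b * α)]) h0.le
    have e2 : |a * β - b * α| ≤ h := abs_le_of_sq_le_sq (by nlinarith [sq_nonneg (a * α + b * β)]) h0.le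
    have e3 : |s * (a * α + b * β)| ≤ S * h := by rw [abs_mul]; gcongr
    have e4 : |s * (a * β - b * α)| ≤ S * h := by rw [abs_mul]; gcongr
    have e5 : s ^ 2 ≤ S ^ 2 := by rw [← sq_abs s]; gcongr
    have e6 : S * h ≤ S ^ 2 := by nlinarith
    have e7 : h ^ 2 ≤ S ^ 2 := by nlinarith
    apply hyp s
    · have : (a + s * α) ^ 2 + (b + s * β) ^ 2 = (a ^ 2 + b ^ 2) + 2 * (s * (a * α + b * β)) + s ^ 2 * (α ^ 2 + β ^ 2) := by ring
      rw [this, hw]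
      have := (abs_le.1 e3).2
      linarith
    · have e8 := abs_le.1 e4
      have e9 := abs_le.1 hc
      rw [abs_le]
      constructor <;> linarith)
  have hs2 : |s| ≤ 2 * h := by
    apply abs_le_of_sq_le_sq _ (by linarith)
    have : s ^ 2 = (a + s * α - a) ^ 2 + (b + s * β - b) ^ 2 := by
      calc s ^ 2 = s ^ 2 * (α ^ 2 + β ^ 2) := by rw [hw, mul_one]
        _ = _ := by ring
    nlinarith [sq_nonneg (a + s * α + a), sq_nonneg (b + s * β + b)]
  have hα : |α| ≤ 1 := abs_le_of_sq_le_sq (by nlinarith [sq_nonneg β]) zero_le_one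
  -- bounds on b and β
  have hb : h * |b| ≤ 12 / 50 * (ε * r) ^ 2 := by
    have t1 : 50 * h * H ^ 2 * |b| ≤ 12 * h ^ 2 * ε ^ 2 := by
      rw [← hSe]; nlinarith [mul_le_mul_of_nonneg_right k1 (sq_nonneg ε)]
    rw [hh] at t1 ⊢
    have e1 : 50 * (H * r) * H ^ 2 * |b| = (H ^ 2) * (50 * (H * r * |b|)) := by ring
    have e2 : 12 * (H * r) ^ 2 * ε ^ 2 = (H ^ 2) * (12 * (ε * r) ^ 2) := by ring
    rw [e1, e2] at t1
    have := le_of_mul_le_mul_left t1 (by positivity)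
    linarith
  have hβ : h ^ 2 * |β| ≤ 30 / 2500 * (ε * r) ^ 2 := by
    have t1 : (50 * h * H ^ 2) ^ 2 * |β| ≤ 30 * h ^ 2 * (ε ^ 2) ^ 2 := by
      rw [← hSe]; nlinarith [mul_le_mul_of_nonneg_right k2 (sq_nonneg (ε ^ 2))]
    have e1 : (50 * h * H ^ 2) ^ 2 * |β| = h ^ 2 * (2500 * (H ^ 4 * |β|)) := by ring
    have e2 : 30 * h ^ 2 * (ε ^ 2) ^ 2 = h ^ 2 * (30 * ε ^ 4) := by ring
    rw [e1, e2] at t1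
    have t2 := le_of_mul_le_mul_left t1 (by positivity)
    have t3 : H ^ 2 * |β| ≤ H ^ 4 * |β| := by
      gcongr
      · norm_num
    have t4 : ε ^ 4 ≤ ε ^ 2 := pow_le_pow_of_le_one hε.le hε1.le (by norm_num)
    have t5 : H ^ 2 * |β| ≤ 30 / 2500 * ε ^ 2 := by linarith
    have := mul_le_mul_of_nonneg_right t5 (sq_nonneg r)
    rw [hh]
    nlinarith
  have hbh : |s| * |b| ≤ 24 / 50 * (ε * r) ^ 2 := by
    have := mul_le_mul_of_nonneg_right hs2 (abs_nonneg b)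
    linarith
  have hβh : |s| * |s| * |β| ≤ 120 / 2500 * (ε * r) ^ 2 := by
    have : |s| * |s| * |β| ≤ (2 * h) * (2 * h) * |β| := by gcongr
    nlinarith
  have hεr : 0 < ε * r := by positivity
  have hle : ε * r ≤ h := by rw [hh]; nlinarith
  constructor
  · have y1 : h * |b + s * β| ≤ (ε * r) * h := by
      have : |b + s * β| ≤ |b| + |s| * |β| := by rw [← abs_mul]; exact abs_add_le _ _
      have z1 : h * |b + s * β| ≤ h * (|b| + |s| * |β|) := by gcongr
      have z2 : h * (|s| * |β|) ≤ h * (2 * h * |β|) := by gcongr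
      nlinarith
    have y2 : |b + s * β| ≤ ε * r := by
      rw [mul_comm] at y1
      exact le_of_mul_le_mul_right y1 h0
    rw [← sq_abs]; gcongr
  · have e : c + s * (a * β - b * α) / 2 - (c - a * b / 2) - (a + s * α) * (b + s * β) / 2
        = -(α * (s * b)) - α * (s * s * β) / 2 := by ring
    rw [e]
    have z1 : |α * (s * b)| ≤ 1 * (24 / 50 * (ε * r) ^ 2) := by
      rw [abs_mul, abs_mul s]; gcongr
    have z2 : |α * (s * s * β)| ≤ 1 * (120 / 2500 * (ε * r) ^ 2) := by
      rw [abs_mul, abs_mul, abs_mul s s]; gcongr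
    rw [abs_le] at *
    constructor <;> nlinarith

/-- Any point of a horizontal line may be used as base point, with unit direction. -/
theorem line_param {L : Set Hei} (hL : IsHorizontalLine L) {p : Hei} (hp : p ∈ L) :
    ∃ e1 e2 : ℝ, e1 ^ 2 + e2 ^ 2 = 1 ∧ L = {q | ∃ s : ℝ, q = Hmul p (s * e1, s * e2, 0)} := by
  obtain ⟨p0, ⟨v1, v2⟩, hv, rfl⟩ := hL
  obtain ⟨s0, rfl⟩ := hp
  have hpos : 0 < v1 ^ 2 + v2 ^ 2 := by
    by_contra hcon
    apply hv
    have h1 : v1 = 0 := by nlinarith [sq_nonneg v1, sq_nonneg v2]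
    have h2 : v2 = 0 := by nlinarith [sq_nonneg v1, sq_nonneg v2]
    simp [h1, h2]
  obtain ⟨l, hl⟩ : ∃ l, l = Real.sqrt (v1 ^ 2 + v2 ^ 2) := ⟨_, rfl⟩
  have hl0 : 0 < l := hl ▸ Real.sqrt_pos.2 hpos
  have hl2 : l ^ 2 = v1 ^ 2 + v2 ^ 2 := hl ▸ Real.sq_sqrt hpos.le
  refine ⟨v1 / l, v2 / l, ?_, ?_⟩
  · field_simp; exact hl2.symm
  · ext q
    simp only [Set.mem_ofPred_eq]
    constructor
    · rintro ⟨s, rfl⟩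
      refine ⟨(s - s0) * l, ?_⟩
      simp only [Hmul, Prod.mk.injEq]
      refine ⟨?_, ?_, ?_⟩ <;> field_simp <;> ring
    · rintro ⟨s, rfl⟩
      refine ⟨s0 + s / l, ?_⟩
      simp only [Hmul, Prod.mk.injEq]
      refine ⟨?_, ?_, ?_⟩ <;> field_simp <;> ring

theorem Hnorm_le_iff_s11 {x y t ρ : ℝ} (hρ : 0 ≤ ρ) :
    Hnorm (x, y, t) ≤ ρ ↔ x ^ 2 + y ^ 2 ≤ ρ ^ 2 ∧ |t| ≤ ρ ^ 2 := by
  simp only [Hnorm, max_le_iff, Real.sqrt_le_left hρ]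

/-- Distance from `q` to a point `p·(0,0,c)·(u e)`, in coordinates adapted to `e`. -/
theorem dist_iff {e1 e2 : ℝ} (he : e1 ^ 2 + e2 ^ 2 = 1) (p q0 : Hei) (w1 w2 s u c ρ : ℝ) (hρ : 0 ≤ ρ)
    {a b t α β : ℝ}
    (ha : a = (q0.1 - p.1) * e1 + (q0.2.1 - p.2.1) * e2)
    (hb : b = (q0.2.1 - p.2.1) * e1 - (q0.1 - p.1) * e2)
    (ht : t = q0.2.2 - p.2.2 - (p.1 * q0.2.1 - q0.1 * p.2.1) / 2)
    (hα : α = w1 * e1 + w2 * e2) (hβ : β = w2 * e1 - w1 * e2) :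
    dH (Hmul q0 (s * w1, s * w2, 0)) (Hmul (Hmul p (0, 0, c)) (u * e1, u * e2, 0)) ≤ ρ ↔
      (a + s * α - u) ^ 2 + (b + s * β) ^ 2 ≤ ρ ^ 2 ∧
      |t + s * (a * β - b * α) / 2 - c - u * (b + s * β) / 2| ≤ ρ ^ 2 := by
  unfold dH
  simp only [Hmul, Hinv]
  rw [Hnorm_le_iff_s11 hρ]
  have E1 : ∀ x y : ℝ, (x * e1 + y * e2 - u) ^ 2 + (y * e1 - x * e2) ^ 2
      = (x - u * e1) ^ 2 + (y - u * e2) ^ 2 := by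
    intro x y
    linear_combination (x ^ 2 + y ^ 2 - u ^ 2) * he
  have E2 : a * β - b * α = (q0.1 - p.1) * w2 - (q0.2.1 - p.2.1) * w1 := by
    rw [ha, hb, hα, hβ]
    linear_combination ((q0.1 - p.1) * w2 - (q0.2.1 - p.2.1) * w1) * he
  have e := E1 (q0.1 - p.1 + s * w1) (q0.2.1 - p.2.1 + s * w2)
  have c1 : (a + s * α - u) ^ 2 + (b + s * β) ^ 2 =
      (-(p.1 + 0 + u * e1) + (q0.1 + s * w1)) ^ 2 + (-(p.2.1 + 0 + u * e2) + (q0.2.1 + s * w2)) ^ 2 := by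
    rw [ha, hb, hα, hβ]
    linear_combination e
  rw [E2, c1, ht, hb, hβ]
  ring_nf

theorem main_aux {ε H r : ℝ} (hε : 0 < ε) (hε1 : ε < 1) (hH : 1 ≤ H) (hr : 0 < r)
    (L₁ L₂ : Set Hei) (h1 : IsHorizontalLine L₁) (h2 : IsHorizontalLine L₂) (p : Hei) (hp : p ∈ L₁)
    (hyp : BH p (100 * H ^ 3 / ε ^ 2 * r) ∩ L₂ ⊆ NH L₁ (H * r)) :
    ∃ L : Set Hei, IsHorizontalLine L ∧ L ⊆ VSpan L₁ ∧ BH p (H * r) ∩ L₂ ⊆ NH L (ε * r) := by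
  by_cases hne : (BH p (H * r) ∩ L₂).Nonempty
  swap
  · rw [Set.not_nonempty_iff_eq_empty] at hne
    refine ⟨L₁, h1, fun q hq => ⟨q, hq, 0, ?_⟩, by rw [hne]; exact Set.empty_subset _⟩
    simp [Hmul]
  obtain ⟨q0, hq0, hq0L⟩ := hne
  obtain ⟨e1, e2, he, rfl⟩ := line_param h1 hp
  obtain ⟨w1, w2, hw, rfl⟩ := line_param h2 hq0L
  have D := fun s u c ρ hρ => dist_iff he p q0 w1 w2 s u c ρ hρ rfl rfl rfl rfl rfl
  generalize (q0.1 - p.1) * e1 + (q0.2.1 - p.2.1) * e2 = a at D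
  generalize (q0.2.1 - p.2.1) * e1 - (q0.1 - p.1) * e2 = b at D
  generalize q0.2.2 - p.2.2 - (p.1 * q0.2.1 - q0.1 * p.2.1) / 2 = t at D
  obtain ⟨α, hα⟩ : ∃ α, α = w1 * e1 + w2 * e2 := ⟨_, rfl⟩
  obtain ⟨β, hβ⟩ : ∃ β, β = w2 * e1 - w1 * e2 := ⟨_, rfl⟩
  rw [← hα, ← hβ] at D
  have hαβ : α ^ 2 + β ^ 2 = 1 := by
    rw [hα, hβ]
    linear_combination (w1 ^ 2 + w2 ^ 2) * he + hw
  have Hp : Hmul (Hmul p (0, 0, 0)) (0 * e1, 0 * e2, 0) = p := by simp [Hmul]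
  have Hp' : Hmul p (0, 0, 0) = p := by simp [Hmul]
  have Hq : Hmul q0 (0 * w1, 0 * w2, 0) = q0 := by simp [Hmul]
  have hHr : 0 < H * r := by positivity
  -- ball membership
  have B : ∀ s ρ, 0 ≤ ρ → (Hmul q0 (s * w1, s * w2, 0) ∈ BH p ρ ↔
      (a + s * α) ^ 2 + (b + s * β) ^ 2 ≤ ρ ^ 2 ∧ |t + s * (a * β - b * α) / 2| ≤ ρ ^ 2) := by
    intro s ρ hρ
    have := D s 0 0 ρ hρ
    rw [Hp] at this
    simpa [BH] using this
  have B0 := B 0 (H * r) hHr.le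
  rw [Hq] at B0
  have B1 := B0.1 hq0
  simp only [zero_mul, add_zero, zero_div] at B1
  have C := core hαβ hH hε hε1 hr B1.1 B1.2 (by
    intro s hs1 hs2
    have hmem := hyp ⟨(B s _ (by positivity)).2 ⟨hs1, hs2⟩, ⟨s, rfl⟩⟩
    have hlt : distH (Hmul q0 (s * w1, s * w2, 0)) {q | ∃ s : ℝ, q = Hmul p (s * e1, s * e2, 0)}
        < 2 * (H * r) := by
      have : distH (Hmul q0 (s * w1, s * w2, 0)) {q | ∃ s : ℝ, q = Hmul p (s * e1, s * e2, 0)}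
        ≤ H * r := hmem
      linarith
    obtain ⟨_, ⟨_, ⟨u, rfl⟩, rfl⟩, hx⟩ := exists_lt_of_csInf_lt
      (Set.Nonempty.image _ ⟨p, hp⟩) hlt
    have := D s u 0 (2 * (H * r)) (by positivity)
    rw [Hp'] at this
    have := this.1 hx.le
    rw [sub_zero] at this
    exact ⟨u, this⟩)
  refine ⟨{q | ∃ s : ℝ, q = Hmul (Hmul p (0, 0, t - a * b / 2)) (s * e1, s * e2, 0)},
    ⟨_, (e1, e2), ?_, rfl⟩, ?_, ?_⟩
  · intro h0
    rw [Prod.mk_eq_zero] at h0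
    rw [h0.1, h0.2] at he
    norm_num at he
  · rintro _ ⟨s, rfl⟩
    refine ⟨_, ⟨s, rfl⟩, t - a * b / 2, ?_⟩
    simp only [Hmul, Prod.mk.injEq]
    refine ⟨?_, ?_, ?_⟩ <;> ring
  · rintro _ ⟨hb, s, rfl⟩
    have hb' := (B s _ hHr.le).1 hb
    obtain ⟨c1, c2⟩ := C s hb'.1
    have hd := (D s (a + s * α) (t - a * b / 2) (ε * r) (by positivity)).2
      ⟨by rw [sub_self]; simpa using c1, c2⟩
    have hbd : BddBelow (dH (Hmul q0 (s * w1, s * w2, 0)) ''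
        {q | ∃ s : ℝ, q = Hmul (Hmul p (0, 0, t - a * b / 2)) (s * e1, s * e2, 0)}) := by
      refine ⟨0, ?_⟩
      rintro _ ⟨q, _, rfl⟩
      exact le_max_of_le_left (Real.sqrt_nonneg _)
    exact le_trans (csInf_le hbd (Set.mem_image_of_mem _ ⟨a + s * α, rfl⟩)) hd

/-- **Lemma 2.2.** A horizontal line close to L₁ can be approximated within the
vertical plane spanned by L₁. -/
theorem approximating_line_in_vertical_plane :
    ∃ A : ℝ, 10 ≤ A ∧
      ∀ ε : ℝ, 0 < ε → ε < 1 → ∀ Hc : ℝ, 1 ≤ Hc →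
        ∀ L₁ L₂ : Set Hei, IsHorizontalLine L₁ → IsHorizontalLine L₂ →
          ∀ p ∈ L₁, ∀ r > (0 : ℝ),
            BH p (A * Hc ^ 3 / ε ^ 2 * r) ∩ L₂ ⊆ NH L₁ (Hc * r) →
            ∃ L : Set Hei, IsHorizontalLine L ∧ L ⊆ VSpan L₁ ∧
              BH p (Hc * r) ∩ L₂ ⊆ NH L (ε * r) := by
  exact ⟨100, by norm_num, fun ε hε hε1 H hH L₁ L₂ h1 h2 p hp r hr hyp =>
    main_aux hε hε1 hH hr L₁ L₂ h1 h2 p hp hyp⟩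

end HeisRug
end

section
/- (Lemma 2.7) Let d be an orderly metric on ℝ, let I ⊂ ℝ be an interval (open or closed), let M ≥ 1 and ε > 0, and let g : I → ℝ be an (M,ε)-QIE from (I,d) to (ℝ,d). Then g is 2Mε-monotone relative to d, and for all a, b ∈ I with a ≤ b, every y lying between g(a) and g(b) satisfies inf_{x ∈ [a,b]} d(y, g(x)) ≤ ε. -/
open scoped ENNReal

namespace HeisRug

/-- Chaining along an interval: a property stable under small `d`-steps propagates. -/
lemma chain_aux (d : ℝ → ℝ → ℝ) (hd : Orderly d) (a b : ℝ) (hab : a ≤ b) (η : ℝ) (hη : 0 < η)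
    (Q : ℝ → Prop)
    (h : ∀ x ∈ Set.Icc a b, ∀ x' ∈ Set.Icc a b, d x x' < η → Q x → Q x') : Q a ↔ Q b := by
  obtain ⟨⟨hsymm, -, -⟩, hcont, -⟩ := hd
  refine isPreconnected_Icc.induction₂ (s := Set.Icc a b) (fun x y => (Q x ↔ Q y)) ?_ ?_ ?_
    (Set.left_mem_Icc.2 hab) (Set.right_mem_Icc.2 hab)
  · intro x hx
    obtain ⟨δ, hδ, hδ'⟩ := hcont x η hη
    have h1 : ∀ᶠ y in nhdsWithin x (Set.Icc a b), |x - y| < δ := by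
      apply Filter.Eventually.filter_mono nhdsWithin_le_nhds
      filter_upwards [Metric.ball_mem_nhds x hδ] with y hy
      rw [Metric.mem_ball, dist_comm, Real.dist_eq] at hy
      exact hy
    filter_upwards [h1, self_mem_nhdsWithin] with y hy hy'
    have h2 := hδ' y hy
    exact ⟨h x hx y hy' h2, h y hy' x hx (by rw [hsymm]; exact h2)⟩
  · intro x y z _ _ _ h1 h2
    exact h1.trans h2
  · intro x y _ _ h1
    exact h1.symm

/-- Sign consistency under enlarging a long pair. -/
lemma extend_aux (d : ℝ → ℝ → ℝ) (hd : Orderly d) (I : Set ℝ) (hI : I.OrdConnected)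
    (M ε : ℝ) (hM : 1 ≤ M) (g : ℝ → ℝ) (hg : IsQIEOn d d I M ε g)
    (a b a' b' : ℝ) (ha : a ∈ I) (hb : b ∈ I) (ha' : a' ∈ I) (hb' : b' ∈ I) (hab : a < b)
    (haa : a' ≤ a) (hbb : b ≤ b') (hlong : 2 * M * ε < d a b) :
    g a < g b ↔ g a' < g b' := by
  have hM0 : 0 < M := by linarith
  have hd' := hd
  obtain ⟨⟨hsymm, -, -⟩, -, hord⟩ := hd'
  have hpos : 0 < M⁻¹ * d a b - 2 * ε := by
    have : M⁻¹ * (2 * M * ε) < M⁻¹ * d a b := mul_lt_mul_of_pos_left hlong (inv_pos.2 hM0)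
    have e : M⁻¹ * (2 * M * ε) = 2 * ε := by field_simp
    linarith
  have key : ∀ x ∈ I, ∀ z ∈ I, ∀ z' ∈ I, d a b ≤ d x z →
      d z z' < (M⁻¹ * d a b - 2 * ε) / M → d (g x) (g z) ≤ d (g z) (g z') → False := by
    intro x hx z hz z' hz' h1 h2 h3
    have h4 := (hg x hx z hz).1
    have h5 := (hg z hz z' hz').2
    rw [lt_div_iff₀ hM0] at h2
    have h6 : M⁻¹ * d a b ≤ M⁻¹ * d x z := mul_le_mul_of_nonneg_left h1 (inv_pos.2 hM0).le
    linarith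
  have s1 : g a < g b ↔ g a < g b' := by
    refine chain_aux d hd b b' hbb _ (div_pos hpos hM0) (fun t => g a < g t) ?_
    intro x hx x' hx' hxx hQ
    by_contra hn
    refine key a ha x (hI.out hb hb' hx) x' (hI.out hb hb' hx') ?_ hxx ?_
    · exact (le_max_left _ _).trans (hord a b x hab.le hx.1)
    · have := (le_max_right _ _).trans (hord (g x') (g a) (g x) (not_lt.1 hn) hQ.le)
      rwa [hsymm (g x') (g x)] at this
  have s2 : g a' < g b' ↔ g a < g b' := by
    refine chain_aux d hd a' a haa _ (div_pos hpos hM0) (fun t => g t < g b') ?_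
    intro x hx x' hx' hxx hQ
    by_contra hn
    refine key b' hb' x (hI.out ha' ha hx) x' (hI.out ha' ha hx') ?_ hxx ?_
    · have h1 := (le_max_left _ _).trans (hord a b b' hab.le hbb)
      have h2 := (le_max_right _ _).trans (hord x a b' hx.2 (hab.le.trans hbb))
      rw [hsymm b' x]
      exact h1.trans h2
    · have := (le_max_left _ _).trans (hord (g x) (g b') (g x') hQ.le (not_lt.1 hn))
      rwa [hsymm (g b') (g x)]
  exact s1.trans s2.symm

/-- **Lemma 2.7.** An (M,ε)-QIE on an interval of ℝ with an orderly metric is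
2Mε-monotone, and its image on [a,b] is ε-dense between g(a) and g(b). -/
theorem QIE_monotone_and_dense
    (d : ℝ → ℝ → ℝ) (hd : Orderly d) (I : Set ℝ) (hI : I.OrdConnected)
    (M ε : ℝ) (hM : 1 ≤ M) (hε : 0 < ε) (g : ℝ → ℝ)
    (hg : IsQIEOn d d I M ε g) :
    ((∀ a ∈ I, ∀ b ∈ I, a < b → 2 * M * ε < d a b → g a < g b) ∨
     (∀ a ∈ I, ∀ b ∈ I, a < b → 2 * M * ε < d a b → g b < g a)) ∧
    (∀ a ∈ I, ∀ b ∈ I, a ≤ b → ∀ y ∈ Set.uIcc (g a) (g b),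
      sInf {s : ℝ | ∃ x ∈ Set.Icc a b, s = d y (g x)} ≤ ε) := by
  have hM0 : 0 < M := by linarith
  have hd' := hd
  obtain ⟨⟨hsymm, hzero, htri⟩, -, hord⟩ := hd'
  have hnn : ∀ x y, 0 ≤ d x y := by
    intro x y
    have h1 := htri x y x
    rw [(hzero x x).2 rfl, hsymm y x] at h1
    linarith
  refine ⟨?_, ?_⟩
  · have hne : ∀ a ∈ I, ∀ b ∈ I, 2 * M * ε < d a b → g a ≠ g b := by
      intro a ha b hb hlong heq
      have h1 := (hg a ha b hb).1
      rw [(hzero _ _).2 heq] at h1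
      have : M⁻¹ * (2 * M * ε) < M⁻¹ * d a b := mul_lt_mul_of_pos_left hlong (inv_pos.2 hM0)
      have e : M⁻¹ * (2 * M * ε) = 2 * ε := by field_simp
      linarith
    by_cases hex : ∃ a ∈ I, ∃ b ∈ I, a < b ∧ 2 * M * ε < d a b ∧ g a < g b
    · left
      obtain ⟨a0, ha0, b0, hb0, hab0, hl0, hg0⟩ := hex
      intro a ha b hb hab hl
      have hmin : min a0 a ∈ I := by rcases min_choice a0 a with h | h <;> rw [h] <;> assumption
      have hmax : max b0 b ∈ I := by rcases max_choice b0 b with h | h <;> rw [h] <;> assumption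
      have h1 := extend_aux d hd I hI M ε hM g hg a0 b0 _ _ ha0 hb0 hmin hmax hab0
        (min_le_left _ _) (le_max_left _ _) hl0
      have h2 := extend_aux d hd I hI M ε hM g hg a b _ _ ha hb hmin hmax hab
        (min_le_right _ _) (le_max_right _ _) hl
      exact h2.2 (h1.1 hg0)
    · right
      intro a ha b hb hab hl
      rcases lt_trichotomy (g a) (g b) with h | h | h
      · exact absurd ⟨a, ha, b, hb, hab, hl, h⟩ hex
      · exact absurd h (hne a ha b hb hl)
      · exact h
  · intro a ha b hb hab y hy
    by_contra hcon
    rw [not_le] at hcon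
    set m := sInf {s : ℝ | ∃ x ∈ Set.Icc a b, s = d y (g x)} with hm
    have hle : ∀ x ∈ Set.Icc a b, m ≤ d y (g x) := by
      intro x hx
      refine csInf_le ⟨0, ?_⟩ ⟨x, hx, rfl⟩
      rintro s ⟨x, -, rfl⟩
      exact hnn _ _
    have hney : ∀ x ∈ Set.Icc a b, y ≠ g x := by
      intro x hx h
      have h1 := hle x hx
      rw [(hzero _ _).2 h] at h1
      linarith
    have hη : 0 < (m - ε) / M := div_pos (by linarith) hM0
    have key : g a < y ↔ g b < y := by
      refine chain_aux d hd a b hab _ hη (fun t => g t < y) ?_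
      intro x hx x' hx' hxx hQ
      by_contra hn
      rw [lt_div_iff₀ hM0] at hxx
      have h1 := (le_max_left _ _).trans (hord (g x) y (g x') hQ.le (not_lt.1 hn))
      have h2 := (hg x (hI.out ha hb hx) x' (hI.out ha hb hx')).2
      have h3 := hle x hx
      rw [hsymm] at h3
      linarith
    have hna := hney a (Set.left_mem_Icc.2 hab)
    have hnb := hney b (Set.right_mem_Icc.2 hab)
    rcases Set.mem_uIcc.1 hy with h | h
    · have := key.1 (lt_of_le_of_ne h.1 hna.symm)
      linarith [h.2]
    · have := key.2 (lt_of_le_of_ne h.1 hnb.symm)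
      linarith [h.2]

end HeisRug
end

section
/- (Lemma 2.10) Let ε > 0, M ≥ 1, and let I, J ⊂ ℝ be intervals with |I| > 2M²·|J|^{1/2} + 4Mε. Let F : I×J → 𝕎 be a horizontal (M,ε)-QIE. Then for any fixed y₀ ∈ I the induced map g(t) := π₂(F(y₀,t)) does not depend on the choice of y₀ ∈ I, and g is an (M,2ε)-QIE from (J, ‖·‖) to (ℝ, ‖·‖), where ‖s − t‖ = |s − t|^{1/2} is the square-root metric on ℝ. -/
open scoped ENNReal

namespace HeisRug

theorem crossing_seq (v : ℕ → ℝ) (p η : ℝ) (N : ℕ) (h0 : v 0 ≤ p) (hN : p ≤ v N)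
    (hη : 0 ≤ η) (hstep : ∀ k < N, |v (k + 1) - v k| ≤ η) : ∃ k ≤ N, |v k - p| ≤ η := by
  by_contra! hcon
  have key : ∀ k ≤ N, v k ≤ p := by
    intro k
    induction k with
    | zero => intro _; exact h0
    | succ k ih =>
      intro hk
      have h1 := ih (by omega)
      have h2 := hcon k (by omega)
      have h3 := abs_le.1 (hstep k (by omega))
      rw [abs_of_nonpos (by linarith)] at h2
      linarith [h3.2]
  have h1 := hcon N le_rfl
  have h2 := key N le_rfl
  have h3 : v N - p = 0 := by linarith
  rw [h3, abs_zero] at h1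
  linarith

theorem crossing (u : ℝ → ℝ) (I : Set ℝ) (hI : I.OrdConnected) (M ε δ p a b : ℝ)
    (hM : 1 ≤ M) (hε : 0 < ε) (hδ : 0 < δ) (ha : a ∈ I) (hb : b ∈ I)
    (hu : ∀ x ∈ I, ∀ y ∈ I, |u x - u y| ≤ M * |x - y| + ε)
    (h0 : u a ≤ p) (h1 : p ≤ u b) : ∃ y ∈ I, |u y - p| ≤ M * δ + ε := by
  obtain ⟨N, hN⟩ := exists_nat_gt (|b - a| / δ)
  have hNpos : (0 : ℝ) < N := lt_of_le_of_lt (by positivity) hN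
  have hmem : ∀ k ≤ N, a + (k : ℝ) / N * (b - a) ∈ I := by
    intro k hk
    have hk' : (k : ℝ) ≤ N := by exact_mod_cast hk
    have := hI.convex.add_smul_sub_mem ha hb
      (t := (k : ℝ) / N) ⟨by positivity, (div_le_one hNpos).2 hk'⟩
    simpa using this
  obtain ⟨k, hk, hkp⟩ := crossing_seq (fun k : ℕ => u (a + (k : ℝ) / N * (b - a))) p (M * δ + ε) N
    (by simpa using h0) (by
      have : a + (N : ℝ) / N * (b - a) = b := by rw [div_self hNpos.ne']; ring
      simpa only [this] using h1) (by positivity) (by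
      intro k hk
      refine (hu _ (hmem _ (by omega)) _ (hmem _ (by omega))).trans ?_
      have : a + ((k + 1 : ℕ) : ℝ) / N * (b - a) - (a + (k : ℝ) / N * (b - a)) = (b - a) / N := by
        push_cast; field_simp; ring
      rw [this, abs_div, abs_of_pos hNpos]
      have : |b - a| / N ≤ δ := by
        rw [div_lt_iff₀ hδ] at hN
        rw [div_le_iff₀ hNpos]; linarith
      have := mul_le_mul_of_nonneg_left this (by linarith : 0 ≤ M)
      linarith)
  exact ⟨_, hmem k hk, hkp⟩

theorem crossing_two (u w : ℝ → ℝ) (I : Set ℝ) (hI : I.OrdConnected) (M ε δ K a b : ℝ)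
    (hM : 1 ≤ M) (hε : 0 < ε) (hδ : 0 < δ) (ha : a ∈ I) (hb : b ∈ I)
    (hu : ∀ x ∈ I, ∀ y ∈ I, |u x - u y| ≤ M * |x - y| + ε)
    (hw : ∀ x ∈ I, ∀ y ∈ I, |w x - w y| ≤ M * |x - y| + ε)
    (hK : ∀ x ∈ I, |u x - w x| ≤ K)
    (hab : u a + 2 * K < u b) : ∃ y ∈ I, ∃ y' ∈ I, |u y - w y'| ≤ M * δ + ε := by
  have h1 := abs_le.1 (hK a ha)
  have h2 := abs_le.1 (hK b hb)
  rcases le_total (u a) (w a) with h | h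
  · obtain ⟨y, hy, hyp⟩ := crossing u I hI M ε δ (w a) a b hM hε hδ ha hb hu h
      (by linarith [h1.1, h1.2])
    exact ⟨y, hy, a, ha, hyp⟩
  · obtain ⟨y, hy, hyp⟩ := crossing w I hI M ε δ (u a) a b hM hε hδ ha hb hw h
      (by linarith [h1.1, h1.2, h2.2])
    exact ⟨a, ha, y, hy, by rwa [abs_sub_comm]⟩

/-- **Lemma 2.10.** The map induced on the second coordinate by a horizontal
(M,ε)-QIE on a sufficiently wide rectangle is an (M,2ε)-QIE for the square-root
metric. -/
theorem horizontal_QIE_induced_map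
    (M ε : ℝ) (hM : 1 ≤ M) (hε : 0 < ε) (I J : Set ℝ)
    (hI : I.OrdConnected) (hJ : J.OrdConnected)
    (F : ℝ × ℝ → ℝ × ℝ) (hF : IsHorizQIE M ε I J F)
    (hlen : ∃ lenJ : ℝ, (∀ t₁ ∈ J, ∀ t₂ ∈ J, |t₁ - t₂| ≤ lenJ) ∧
      ∃ y₁ ∈ I, ∃ y₂ ∈ I, 2 * M ^ 2 * Real.sqrt lenJ + 4 * M * ε < |y₁ - y₂|) :
    (∀ y₀ ∈ I, ∀ y₁ ∈ I, ∀ t ∈ J, (F (y₀, t)).2 = (F (y₁, t)).2) ∧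
    (∀ y₀ ∈ I, ∀ t ∈ J, ∀ t' ∈ J,
      M⁻¹ * Real.sqrt |t - t'| - 2 * ε ≤ Real.sqrt |(F (y₀, t)).2 - (F (y₀, t')).2| ∧
      Real.sqrt |(F (y₀, t)).2 - (F (y₀, t')).2| ≤ M * Real.sqrt |t - t'| + 2 * ε) := by
  obtain ⟨hQ, hH⟩ := hF
  have hM0 : 0 < M := by linarith
  have hconst : ∀ y₀ ∈ I, ∀ y₁ ∈ I, ∀ t ∈ J, (F (y₀, t)).2 = (F (y₁, t)).2 := by
    intro y₀ h0 y₁ h1 t ht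
    obtain ⟨c, hc⟩ := hH t ht
    rw [hc _ h0, hc _ h1]
  refine ⟨hconst, ?_⟩
  intro y₀ hy₀ t ht t' ht'
  have hsame : ∀ t ∈ J, ∀ x ∈ I, ∀ y ∈ I, M⁻¹ * |x - y| - ε ≤ |(F (x, t)).1 - (F (y, t)).1| ∧
      |(F (x, t)).1 - (F (y, t)).1| ≤ M * |x - y| + ε := by
    intro t ht x hx y hy
    have := hQ (x, t) ⟨hx, ht⟩ (y, t) ⟨hy, ht⟩
    simpa [dPar, hconst x hx y hy t ht] using this
  have hvert : ∀ x ∈ I, dPar (F (x, t)) (F (x, t')) ≤ M * Real.sqrt |t - t'| + ε := by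
    intro x hx
    have := (hQ (x, t) ⟨hx, ht⟩ (x, t') ⟨hx, ht'⟩).2
    simpa [dPar] using this
  refine ⟨?_, ((le_max_right _ _).trans (hvert y₀ hy₀)).trans (by linarith)⟩
  by_contra! hcon
  obtain ⟨lenJ, hJl, y₁, hy₁, y₂, hy₂, hlt⟩ := hlen
  set s := Real.sqrt |t - t'| with hs
  have hsl : s ≤ Real.sqrt lenJ := Real.sqrt_le_sqrt (hJl t ht t' ht')
  have hpos : 0 < M⁻¹ * s - 2 * ε := lt_of_le_of_lt (Real.sqrt_nonneg _) hcon
  have hlow : ∀ x ∈ I, ∀ y ∈ I, M⁻¹ * s - ε ≤ |(F (x, t)).1 - (F (y, t')).1| := by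
    intro x hx y hy
    have h1 := (hQ (x, t) ⟨hx, ht⟩ (y, t') ⟨hy, ht'⟩).1
    have h2 : s ≤ dPar (x, t) (y, t') := le_max_right _ _
    have h3 := mul_le_mul_of_nonneg_left h2 (inv_nonneg.2 hM0.le)
    have h4 : M⁻¹ * s - ε ≤ dPar (F (x, t)) (F (y, t')) := by linarith
    rcases le_max_iff.1 h4 with h | h
    · exact h
    · rw [hconst x hx y₀ hy₀ t ht, hconst y hy y₀ hy₀ t' ht'] at h
      linarith
  have hwide : ∀ x ∈ I, ∀ y ∈ I, 2 * M ^ 2 * Real.sqrt lenJ + 4 * M * ε < |x - y| →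
      2 * (M * s + ε) < |(F (x, t)).1 - (F (y, t)).1| := by
    intro x hx y hy h
    have h1 := (hsame t ht x hx y hy).1
    have h2 := mul_lt_mul_of_pos_left h (inv_pos.2 hM0)
    have h3 : M⁻¹ * (2 * M ^ 2 * Real.sqrt lenJ + 4 * M * ε) = 2 * (M * Real.sqrt lenJ) + 4 * ε := by
      field_simp
    have h4 := mul_le_mul_of_nonneg_left hsl hM0.le
    linarith
  have hδ : 0 < (M⁻¹ * s - 2 * ε) / (2 * M) := by positivity
  have main : ∀ a ∈ I, ∀ b ∈ I, (F (a, t)).1 + 2 * (M * s + ε) < (F (b, t)).1 → False := by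
    intro a ha b hb hab
    obtain ⟨y, hy, y', hy', h⟩ := crossing_two (fun y => (F (y, t)).1) (fun y => (F (y, t')).1) I hI
      M ε _ (M * s + ε) a b hM hε hδ ha hb (fun x hx y hy => (hsame t ht x hx y hy).2)
      (fun x hx y hy => (hsame t' ht' x hx y hy).2)
      (fun x hx => (le_max_left _ _).trans (hvert x hx)) hab
    have h1 := hlow y hy y' hy'
    have h2 : M * ((M⁻¹ * s - 2 * ε) / (2 * M)) = (M⁻¹ * s - 2 * ε) / 2 := by
      field_simp
    rw [h2] at h
    linarith
  have hw := hwide y₁ hy₁ y₂ hy₂ hlt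
  rcases lt_abs.1 hw with h | h
  · exact main y₂ hy₂ y₁ hy₁ (by linarith)
  · exact main y₁ hy₁ y₂ hy₂ (by linarith)

end HeisRug
end

section
/- (Corollary 2.13) Let M ≥ 1, ε > 0, and let I, J ⊂ ℝ be intervals with |I| > 2M²·|J|^{1/2} + 4Mε. Then every horizontal (M,ε)-QIE F : I×J → 𝕎 is vertically 4Mε-monotone. -/
open scoped ENNReal

namespace HeisRug

/-- Sign of a function with small jumps which stays away from zero is constant. -/
theorem sign_const {X : Type*} [PseudoMetricSpace X] {S : Set X} (hS : IsPreconnected S)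
    (φ : X → ℝ) (r κ : ℝ) (hr : 0 < r)
    (hj : ∀ x ∈ S, ∀ y ∈ S, dist x y < r → |φ x - φ y| ≤ 2 * κ)
    (hb : ∀ x ∈ S, κ < |φ x|) {x y : X} (hx : x ∈ S) (hy : y ∈ S) (h : 0 < φ x) : 0 < φ y := by
  have key : ∀ a ∈ S, ∀ b ∈ S, dist a b < r → 0 < φ a → 0 < φ b := by
    intro a ha b hb' hab h0
    have h1 := hj a ha b hb' hab
    have h2 := hb a ha
    have h3 := hb b hb'
    rw [abs_of_pos h0] at h2
    by_contra hneg
    rw [abs_of_nonpos (not_lt.mp hneg)] at h3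
    have := (abs_le.mp h1).2
    linarith
  by_contra hneg
  let U : Set X := {z | ∃ a ∈ S, 0 < φ a ∧ dist z a < r / 2}
  let V : Set X := {z | ∃ a ∈ S, ¬ 0 < φ a ∧ dist z a < r / 2}
  have hop : ∀ P : X → Prop, IsOpen {z | ∃ a ∈ S, P a ∧ dist z a < r / 2} := by
    intro P
    have : {z | ∃ a ∈ S, P a ∧ dist z a < r / 2} = ⋃ a ∈ {a | a ∈ S ∧ P a}, Metric.ball a (r / 2) := by
      ext z; simp [and_assoc]
    rw [this]
    exact isOpen_biUnion fun _ _ => Metric.isOpen_ball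
  have hU : IsOpen U := hop (fun a => 0 < φ a)
  have hV : IsOpen V := hop (fun a => ¬ 0 < φ a)
  have hcov : S ⊆ U ∪ V := by
    intro z hz
    by_cases hp : 0 < φ z
    · exact Or.inl ⟨z, hz, hp, by simp [hr]⟩
    · exact Or.inr ⟨z, hz, hp, by simp [hr]⟩
  obtain ⟨z, hz, ⟨a, ha, hpa, hza⟩, ⟨b, hb', hpb, hzb⟩⟩ := hS U V hU hV hcov
    ⟨x, hx, x, hx, h, by simp [hr]⟩ ⟨y, hy, y, hy, hneg, by simp [hr]⟩
  refine hpb (key a ha b hb' ?_ hpa)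
  have := dist_triangle_left a b z
  linarith

/-- Coarse intermediate value theorem. -/
theorem coarse_ivt {I : Set ℝ} (hI : IsPreconnected I) (g : ℝ → ℝ) (r κ : ℝ) (hr : 0 < r)
    (hκ : 0 < κ)
    (hj : ∀ x ∈ I, ∀ y ∈ I, |x - y| < r → |g x - g y| ≤ 2 * κ) {a b v : ℝ}
    (ha : a ∈ I) (hb : b ∈ I) (hav : g a ≤ v) (hvb : v ≤ g b) : ∃ x ∈ I, |g x - v| ≤ κ := by
  by_contra hcon
  push Not at hcon
  have h1 := hcon b hb
  have hpos : 0 < g b - v := by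
    rw [abs_of_nonneg (by linarith)] at h1; linarith
  have := sign_const hI (fun x => g x - v) r κ hr (by
    intro x hx y hy hxy
    have := hj x hx y hy (by rwa [Real.dist_eq] at hxy)
    simpa using this) hcon hb ha hpos
  linarith

/-- **Corollary 2.13.** A horizontal (M,ε)-QIE on a sufficiently wide rectangle
is vertically 4Mε-monotone. -/
theorem horizontal_QIE_vertically_monotone
    (M ε : ℝ) (hM : 1 ≤ M) (hε : 0 < ε) (I J : Set ℝ)
    (hI : I.OrdConnected) (hJ : J.OrdConnected)
    (F : ℝ × ℝ → ℝ × ℝ) (hF : IsHorizQIE M ε I J F)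
    (hlen : ∃ lenJ : ℝ, (∀ t₁ ∈ J, ∀ t₂ ∈ J, |t₁ - t₂| ≤ lenJ) ∧
      ∃ y₁ ∈ I, ∃ y₂ ∈ I, 2 * M ^ 2 * Real.sqrt lenJ + 4 * M * ε < |y₁ - y₂|) :
    (∀ y ∈ I, ∀ t₁ ∈ J, ∀ t₂ ∈ J, t₁ < t₂ → 4 * M * ε < Real.sqrt |t₁ - t₂| →
      (F (y, t₁)).2 < (F (y, t₂)).2) ∨
    (∀ y ∈ I, ∀ t₁ ∈ J, ∀ t₂ ∈ J, t₁ < t₂ → 4 * M * ε < Real.sqrt |t₁ - t₂| →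
      (F (y, t₂)).2 < (F (y, t₁)).2) := by
  obtain ⟨lenJ, hlenJ, y₁, hy₁, y₂, hy₂, hwide⟩ := hlen
  obtain ⟨hQ, hH⟩ := hF
  have hM0 : 0 < M := by linarith
  obtain ⟨h, hh⟩ : ∃ h : ℝ → ℝ, ∀ t ∈ J, ∀ y ∈ I, (F (y, t)).2 = h t :=
    ⟨fun t => (F (y₁, t)).2, fun t ht y hy => by
      obtain ⟨c, hc⟩ := hH t ht
      simp only
      rw [hc y hy, hc y₁ hy₁]⟩
  -- coordinates
  have hf : ∀ t ∈ J, ∀ y ∈ I, ∀ y' ∈ I, |y - y'| ≤ M * (|(F (y, t)).1 - (F (y', t)).1| + ε) ∧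
      |(F (y, t)).1 - (F (y', t)).1| ≤ M * |y - y'| + ε := by
    intro t ht y hy y' hy'
    have h1 := hQ (y, t) ⟨hy, ht⟩ (y', t) ⟨hy', ht⟩
    simp only [dPar, hh t ht y hy, hh t ht y' hy', sub_self, abs_zero, Real.sqrt_zero] at h1
    rw [max_eq_left (abs_nonneg _), max_eq_left (abs_nonneg _)] at h1
    refine ⟨?_, h1.2⟩
    rw [← inv_mul_le_iff₀ hM0]
    linarith [h1.1]
  have hv : ∀ t ∈ J, ∀ t' ∈ J, ∀ y ∈ I,
      |(F (y, t)).1 - (F (y, t')).1| ≤ M * Real.sqrt |t - t'| + ε ∧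
      Real.sqrt |h t - h t'| ≤ M * Real.sqrt |t - t'| + ε := by
    intro t ht t' ht' y hy
    have h1 := (hQ (y, t) ⟨hy, ht⟩ (y, t') ⟨hy, ht'⟩).2
    simp only [dPar, hh t ht y hy, hh t' ht' y hy, sub_self, abs_zero] at h1
    rw [max_eq_right (Real.sqrt_nonneg |t - t'|)] at h1
    exact ⟨(le_max_left _ _).trans h1, (le_max_right _ _).trans h1⟩
  have hjump : ∀ t ∈ J, ∀ x ∈ I, ∀ y ∈ I, |x - y| < ε / M →
      |(F (x, t)).1 - (F (y, t)).1| ≤ 2 * ε := by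
    intro t ht x hx y hy hxy
    have h1 := (hf t ht x hx y hy).2
    rw [lt_div_iff₀ hM0] at hxy
    linarith
  have hIc : IsPreconnected I := hI.isPreconnected
  -- ranges meet
  have hmeet : ∀ t ∈ J, ∀ t' ∈ J, ∃ y ∈ I, ∃ y' ∈ I, |(F (y, t)).1 - (F (y', t')).1| ≤ ε := by
    intro t ht t' ht'
    have hs : Real.sqrt |t - t'| ≤ Real.sqrt lenJ := Real.sqrt_le_sqrt (hlenJ t ht t' ht')
    have hs' := mul_le_mul_of_nonneg_left hs hM0.le
    have main : ∀ a ∈ I, ∀ b ∈ I, 2 * M ^ 2 * Real.sqrt lenJ + 4 * M * ε < |a - b| →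
        (F (a, t)).1 ≤ (F (b, t)).1 →
        ∃ y ∈ I, ∃ y' ∈ I, |(F (y, t)).1 - (F (y', t')).1| ≤ ε := by
      intro a ha b hb hab hle
      have h1 := (hf t ht a ha b hb).1
      have h2 : M * (2 * M * Real.sqrt lenJ + 3 * ε) <
          M * |(F (a, t)).1 - (F (b, t)).1| := by nlinarith
      have h3 := lt_of_mul_lt_mul_left h2 hM0.le
      rw [abs_sub_comm, abs_of_nonneg (sub_nonneg.mpr hle)] at h3
      have h4 := abs_le.mp (hv t ht t' ht' a ha).1
      have h5 := abs_le.mp (hv t ht t' ht' b hb).1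
      rcases le_total (F (a, t)).1 (F (a, t')).1 with hc | hc
      · obtain ⟨x, hx, hx'⟩ := coarse_ivt hIc (fun y => (F (y, t)).1) (ε / M) ε (by positivity) hε
          (hjump t ht) ha hb (v := (F (a, t')).1) hc (by nlinarith [Real.sqrt_nonneg lenJ])
        exact ⟨x, hx, a, ha, hx'⟩
      · obtain ⟨x, hx, hx'⟩ := coarse_ivt hIc (fun y => (F (y, t')).1) (ε / M) ε (by positivity) hε
          (hjump t' ht') ha hb (v := (F (a, t)).1) hc (by nlinarith [Real.sqrt_nonneg lenJ])
        exact ⟨a, ha, x, hx, by rw [abs_sub_comm]; exact hx'⟩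
    rcases le_total (F (y₁, t)).1 (F (y₂, t)).1 with hc | hc
    · exact main y₁ hy₁ y₂ hy₂ hwide hc
    · exact main y₂ hy₂ y₁ hy₁ (by rwa [abs_sub_comm]) hc
  have hlow : ∀ t ∈ J, ∀ t' ∈ J, 4 * M * ε < Real.sqrt |t - t'| →
      4 * ε ^ 2 < |h t - h t'| := by
    intro t ht t' ht' hbig
    obtain ⟨y, hy, y', hy', hyy⟩ := hmeet t ht t' ht'
    have h1 := (hQ (y, t) ⟨hy, ht⟩ (y', t') ⟨hy', ht'⟩).1
    simp only [dPar, hh t ht y hy, hh t' ht' y' hy'] at h1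
    have h2 : M⁻¹ * (4 * M * ε) < M⁻¹ * max |y - y'| (Real.sqrt |t - t'|) :=
      mul_lt_mul_of_pos_left (hbig.trans_le (le_max_right _ _)) (by positivity)
    have h3 : M⁻¹ * (4 * M * ε) = 4 * ε := by field_simp
    have h4 : 3 * ε < max |(F (y, t)).1 - (F (y', t')).1| (Real.sqrt |h t - h t'|) := by linarith
    rcases lt_max_iff.mp h4 with h5 | h5
    · linarith
    · have h6 := (Real.lt_sqrt (by positivity)).mp h5
      nlinarith
  have hjh : ∀ t ∈ J, ∀ t' ∈ J, |t - t'| < (ε / M) ^ 2 → |h t - h t'| ≤ 4 * ε ^ 2 := by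
    intro t ht t' ht' htt
    have h1 := (hv t ht t' ht' y₁ hy₁).2
    have h2 : Real.sqrt |t - t'| < ε / M := (Real.sqrt_lt' (by positivity)).mpr htt
    rw [lt_div_iff₀ hM0] at h2
    have h3 : Real.sqrt |h t - h t'| ≤ 2 * ε := by linarith
    have h4 := (Real.sqrt_le_left (by positivity)).mp h3
    linarith
  let D : Set (ℝ × ℝ) := {p | p.1 ∈ J ∧ p.2 ∈ J ∧ (4 * M * ε) ^ 2 < p.2 - p.1}
  have hmem : ∀ t₁ ∈ J, ∀ t₂ ∈ J, t₁ < t₂ → 4 * M * ε < Real.sqrt |t₁ - t₂| → (t₁, t₂) ∈ D := by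
    intro t₁ h₁ t₂ h₂ hlt hb
    have := (Real.lt_sqrt (by positivity)).mp hb
    rw [abs_sub_comm, abs_of_pos (sub_pos.mpr hlt)] at this
    exact ⟨h₁, h₂, this⟩
  have hDb : ∀ p ∈ D, 4 * ε ^ 2 < |h p.2 - h p.1| := by
    rintro ⟨a, b⟩ ⟨ha, hb, hab⟩
    refine hlow b hb a ha ((Real.lt_sqrt (by positivity)).mpr ?_)
    exact lt_of_lt_of_le hab (le_abs_self _)
  have hDc : IsPreconnected D := by
    apply Convex.isPreconnected
    have hJc : Convex ℝ J := hJ.convex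
    rintro ⟨a, b⟩ ⟨ha, hb, hab⟩ ⟨c, d⟩ ⟨hc, hd, hcd⟩ u v hu hv huv
    refine ⟨hJc ha hc hu hv huv, hJc hb hd hu hv huv, ?_⟩
    simp only [Prod.smul_mk, Prod.mk_add_mk, smul_eq_mul] at *
    obtain rfl : v = 1 - u := by linarith
    rcases hu.eq_or_lt with rfl | hu
    · linarith
    · nlinarith [mul_lt_mul_of_pos_left hab hu, mul_le_mul_of_nonneg_left hcd.le hv]
  have hDj : ∀ x ∈ D, ∀ y ∈ D, dist x y < (ε / M) ^ 2 →
      |(h x.2 - h x.1) - (h y.2 - h y.1)| ≤ 2 * (4 * ε ^ 2) := by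
    rintro ⟨a, b⟩ ⟨ha, hb, -⟩ ⟨c, d⟩ ⟨hc, hd, -⟩ hdist
    rw [Prod.dist_eq, max_lt_iff, Real.dist_eq, Real.dist_eq] at hdist
    have h1 := abs_le.mp (hjh a ha c hc hdist.1)
    have h2 := abs_le.mp (hjh b hb d hd hdist.2)
    simp only
    rw [abs_le]
    constructor <;> linarith
  by_cases hex : ∃ p ∈ D, 0 < h p.2 - h p.1
  · obtain ⟨p, hp, hpos⟩ := hex
    left
    intro y hy t₁ h₁ t₂ h₂ hlt hb
    have := sign_const hDc (fun p => h p.2 - h p.1) ((ε / M) ^ 2) (4 * ε ^ 2) (by positivity)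
      hDj hDb hp (hmem t₁ h₁ t₂ h₂ hlt hb) hpos
    rw [hh t₁ h₁ y hy, hh t₂ h₂ y hy]
    simpa using this
  · right
    intro y hy t₁ h₁ t₂ h₂ hlt hb
    have hD := hmem t₁ h₁ t₂ h₂ hlt hb
    rw [hh t₁ h₁ y hy, hh t₂ h₂ y hy]
    by_contra hcon
    have h1 := hDb _ hD
    simp only at h1
    rw [abs_of_nonneg (by linarith)] at h1
    exact hex ⟨_, hD, by simp only; nlinarith [sq_nonneg ε]⟩

end HeisRug
end

section
/- (Lemma 2.16) Let Q = I×J ⊂ 𝕎 be a rectangle, let M ≥ 1 and ε > 0, and let F : Q → 𝕎 be a horizontal (M,ε)-QIE. Assume w₁ = (y₁,t₁), w₂ = (y₂,t₂) ∈ Q satisfy |y₂ − y₁| > max{8Mε, 4M²·|t₁ − t₂|^{1/2}}. Then |π₁(F(w₂)) − π₁(F(w₁))| ≥ |y₂ − y₁|/(2M). -/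
open scoped ENNReal

namespace HeisRug

/-- **Lemma 2.16.** First coordinate separation for horizontal QIEs. -/
theorem horizontal_QIE_first_coordinate_separation
    (M ε : ℝ) (hM : 1 ≤ M) (hε : 0 < ε) (I J : Set ℝ)
    (hI : I.OrdConnected) (hJ : J.OrdConnected)
    (F : ℝ × ℝ → ℝ × ℝ) (hF : IsHorizQIE M ε I J F)
    (y₁ t₁ y₂ t₂ : ℝ) (h₁ : (y₁, t₁) ∈ I ×ˢ J) (h₂ : (y₂, t₂) ∈ I ×ˢ J)
    (hsep : max (8 * M * ε) (4 * M ^ 2 * Real.sqrt |t₁ - t₂|) < |y₂ - y₁|) :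
    |y₂ - y₁| / (2 * M) ≤ |(F (y₂, t₂)).1 - (F (y₁, t₁)).1| := by
  obtain ⟨hQ, hH⟩ := hF
  obtain ⟨hy₁, ht₁⟩ := h₁
  obtain ⟨hy₂, ht₂⟩ := h₂
  simp only at hy₁ ht₁ hy₂ ht₂
  have hM0 : 0 < M := by linarith
  have hs1 : 8 * M * ε < |y₂ - y₁| := lt_of_le_of_lt (le_max_left _ _) hsep
  have hs2 : 4 * M ^ 2 * Real.sqrt |t₁ - t₂| < |y₂ - y₁| :=
    lt_of_le_of_lt (le_max_right _ _) hsep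
  have hlow := (hQ (y₂, t₂) ⟨hy₂, ht₂⟩ (y₁, t₁) ⟨hy₁, ht₁⟩).1
  have hup := (hQ (y₁, t₁) ⟨hy₁, ht₁⟩ (y₁, t₂) ⟨hy₁, ht₂⟩).2
  obtain ⟨c, hc⟩ := hH t₂ ht₂
  have e : (F (y₁, t₂)).2 = (F (y₂, t₂)).2 := by rw [hc y₁ hy₁, hc y₂ hy₂]
  have hd : |y₂ - y₁| ≤ dPar (y₂, t₂) (y₁, t₁) := le_max_left _ _
  have hd' : dPar (y₁, t₁) (y₁, t₂) = Real.sqrt |t₁ - t₂| := by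
    simp [dPar]
  have hv : Real.sqrt |(F (y₂, t₂)).2 - (F (y₁, t₁)).2| ≤ M * Real.sqrt |t₁ - t₂| + ε := by
    rw [← hd', ← e, abs_sub_comm]
    exact (le_max_right _ _).trans hup
  -- work with `a = |y₂ - y₁| / M`
  obtain ⟨a, ha⟩ : ∃ a, a = |y₂ - y₁| / M := ⟨_, rfl⟩
  have haM : |y₂ - y₁| = M * a := by rw [ha]; field_simp
  have h1 : 8 * ε < a := by
    rw [haM] at hs1
    exact lt_of_mul_lt_mul_left (by linarith) hM0.le
  have h2 : 4 * (M * Real.sqrt |t₁ - t₂|) < a := by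
    rw [haM] at hs2
    exact lt_of_mul_lt_mul_left (by linarith) hM0.le
  have h3 : a ≤ M⁻¹ * dPar (y₂, t₂) (y₁, t₁) := by
    rw [ha, div_eq_inv_mul]
    exact mul_le_mul_of_nonneg_left hd (inv_nonneg.2 hM0.le)
  have h4 : |y₂ - y₁| / (2 * M) = a / 2 := by
    rw [haM]; field_simp
  have h5 : a - ε ≤ max |(F (y₂, t₂)).1 - (F (y₁, t₁)).1|
      (Real.sqrt |(F (y₂, t₂)).2 - (F (y₁, t₁)).2|) := by
    refine le_trans ?_ hlow
    linarith
  rw [h4]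
  rcases le_max_iff.1 h5 with h | h
  · linarith
  · linarith

end HeisRug
end

section
/- (Lemma 3.13) There exists an absolute constant A ≥ 1 such that for all a, b ∈ ℝ the following holds for the vertical plane 𝕍 = {(ay+b, y, t) : y, t ∈ ℝ} ⊂ ℍ and the map π_𝕍 : ℍ → 𝕎 defined by π_𝕍(x,y,t) = (y, t + xy/2 − ay²/2 − by): (a) π_𝕍 maps every horizontal line contained in 𝕍, i.e. every set {(ay+b, y, c + by/2) : y ∈ ℝ} with c ∈ ℝ, onto a horizontal line ℝ×{c'} ⊂ 𝕎; and (b) the restriction of π_𝕍 to 𝕍 is A(1+|a|)-bilipschitz from (𝕍, d) onto (𝕎, d_par), i.e. d(p,p')/(A(1+|a|)) ≤ d_par(π_𝕍(p), π_𝕍(p')) ≤ A(1+|a|)·d(p,p') for all p, p' ∈ 𝕍. -/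
open scoped ENNReal

namespace HeisRug

/-- The map π_𝕍 : ℍ → 𝕎 associated to the vertical plane
𝕍 = {(ay+b, y, t)}:  π_𝕍(x,y,t) = (y, t + xy/2 − ay²/2 − by). -/
noncomputable def piVproj (a b : ℝ) (p : Hei) : ℝ × ℝ :=
  (p.2.1, p.2.2 + p.1 * p.2.1 / 2 - a * p.2.1 ^ 2 / 2 - b * p.2.1)

/-- **Lemma 3.13.** π_𝕍 maps horizontal lines of 𝕍 onto horizontal lines of 𝕎
and is A(1+|a|)-bilipschitz on 𝕍. -/
theorem piV_maps_lines_and_is_bilipschitz :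
    ∃ A : ℝ, 1 ≤ A ∧ ∀ a b : ℝ,
      (∀ c : ℝ, ∃ c' : ℝ, piVproj a b '' hline a b c = lineW c') ∧
      (∀ p ∈ {p : Hei | p.1 = a * p.2.1 + b}, ∀ p' ∈ {p : Hei | p.1 = a * p.2.1 + b},
        dH p p' / (A * (1 + |a|)) ≤ dPar (piVproj a b p) (piVproj a b p') ∧
        dPar (piVproj a b p) (piVproj a b p') ≤ A * (1 + |a|) * dH p p') := by
  refine ⟨1, le_refl 1, fun a b => ⟨fun c => ⟨c, ?_⟩, ?_⟩⟩
  · ext ⟨y, t⟩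
    simp only [Set.mem_image, hline, lineW, Set.mem_setOf_eq, piVproj]
    constructor
    · rintro ⟨p, ⟨z, rfl⟩, h⟩
      rw [Prod.mk.injEq] at h
      rw [← h.2]
      ring
    · rintro rfl
      refine ⟨_, ⟨y, rfl⟩, ?_⟩
      rw [Prod.mk.injEq]
      exact ⟨rfl, by ring⟩
  · rintro ⟨x, y, t⟩ hp ⟨x', y', t'⟩ hp'
    simp only [Set.mem_setOf_eq] at hp hp'
    subst hp hp'
    have hd : dH (a * y + b, y, t) (a * y' + b, y', t') =
        max (Real.sqrt ((a * (y - y')) ^ 2 + (y - y') ^ 2))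
          (Real.sqrt |t - t' - b * (y - y') / 2|) := by
      simp only [dH, Hnorm, Hmul, Hinv]
      congr 2
      · ring
      · congr 1
        ring
    have hq : dPar (piVproj a b (a * y + b, y, t)) (piVproj a b (a * y' + b, y', t')) =
        max |y - y'| (Real.sqrt |t - t' - b * (y - y') / 2|) := by
      simp only [dPar, piVproj]
      congr 3
      ring
    rw [hd, hq]
    generalize Real.sqrt |t - t' - b * (y - y') / 2| = r at *
    generalize y - y' = δ
    have ha : 0 ≤ |a| := abs_nonneg a
    have h1 : |δ| ≤ Real.sqrt ((a * δ) ^ 2 + δ ^ 2) :=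
      Real.abs_le_sqrt (by nlinarith [sq_nonneg (a * δ)])
    have h2 : Real.sqrt ((a * δ) ^ 2 + δ ^ 2) ≤ (1 + |a|) * |δ| := by
      apply Real.sqrt_le_iff.mpr
      refine ⟨by positivity, ?_⟩
      have e1 : ((1 + |a|) * |δ|) ^ 2 = (a * δ) ^ 2 + δ ^ 2 + 2 * |a| * δ ^ 2 := by
        rw [mul_pow, sq_abs, add_sq, sq_abs]
        ring
      rw [e1]
      have : 0 ≤ 2 * |a| * δ ^ 2 := by positivity
      linarith
    have hm : 0 ≤ max |δ| r := le_max_of_le_left (abs_nonneg δ)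
    have hm' : max |δ| r ≤ max (Real.sqrt ((a * δ) ^ 2 + δ ^ 2)) r := max_le_max h1 le_rfl
    constructor
    · rw [div_le_iff₀ (by positivity), one_mul]
      apply max_le
      · calc _ ≤ _ := h2
          _ ≤ (1 + |a|) * max |δ| r := by gcongr; exact le_max_left _ _
          _ = _ := mul_comm _ _
      · have := le_max_right |δ| r
        nlinarith
    · rw [one_mul]
      nlinarith

end HeisRug
end
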